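/- Let n ≥ 1. There exist a function Ω : (0,∞)×ℕ → ℝ and constants 0 < c₁ ≤ c₂ and C > 0 with c₁ ≤ Ω(λ,k) ≤ c₂ for all (λ,k), such that for every k ∈ ℕ and every λ with 0 < λ ≤ ν (where ν = 4k+2n), one has |χ̂_B(λ,k) − (sin λ/λ)·(λν)^{−n/2}·J_n(ν·A(λ/(2ν)))·Ω(λ,k)| ≤ C·(|sin λ|/λ)·ν^{−2}·⟨λν⟩^{−n/2+1/4}. -/

import Mathlib

open MeasureTheory Complex

noncomputable section

/-- The generalized Laguerre polynomials
`L_k^δ(t) = t^{−δ} e^t (1/k!) (d/dt)^k (e^{−t} t^{k+δ})`. -/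
def genLaguerre (k : ℕ) (δ : ℝ) (t : ℝ) : ℝ :=
  t ^ (-δ) * Real.exp t * ((k.factorial : ℝ))⁻¹ *
    iteratedDeriv k (fun s => Real.exp (-s) * s ^ ((k : ℝ) + δ)) t

/-- The normalizing constant `r_k = (k!/(n+k−1)!)^{1/2}`. -/
def rk (n k : ℕ) : ℝ := Real.sqrt ((k.factorial : ℝ) / ((n + k - 1).factorial : ℝ))

/-- The Laguerre functions `Λ_k^{n−1}(t) = r_k L_k^{n−1}(t) e^{−t/2} t^{(n−1)/2}`. -/
def lagFun (n k : ℕ) (t : ℝ) : ℝ :=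
  rk n k * genLaguerre k ((n : ℝ) - 1) t * Real.exp (-t / 2) * t ^ (((n : ℝ) - 1) / 2)

/-- The radial Fourier coefficient
`f̂(λ,k) = r_k ∫₀^∞ f_#^λ(r) (|λ|r²)^{(1−n)/2} Λ_k^{n−1}(|λ|r²/2) r^{2n−1} dr`,
where `f_#^λ(r) = ∫_ℝ f_#(r,t) e^{iλt} dt`. -/
def radialCoeff (n : ℕ) (fsharp : ℝ → ℝ → ℂ) (lam : ℝ) (k : ℕ) : ℂ :=
  (rk n k : ℂ) * ∫ r in Set.Ioi (0 : ℝ),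
    (∫ t : ℝ, fsharp r t * Complex.exp (Complex.I * (lam : ℂ) * (t : ℂ))) *
      (((|lam| * r ^ 2) ^ ((1 - (n : ℝ)) / 2) : ℝ) : ℂ) *
      ((lagFun n k (|lam| * r ^ 2 / 2) : ℝ) : ℂ) *
      ((r ^ (2 * (n : ℝ) - 1) : ℝ) : ℂ)

/-- `ν = 4k + 2n`. -/
def nuv (n k : ℕ) : ℕ := 4 * k + 2 * n

/-- The radial Fourier coefficient of the indicator of `B = {(z,t) : |z| ≤ 1, |t| ≤ 1}`:
`χ̂_B(λ,k) = r_k (sin λ/λ^{n+1}) (2ν)^{(n+1)/2} ∫₀^{λ/(2ν)} Λ_k^{n−1}(νt) t^{(n−1)/2} dt`. -/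
def chiHatB (n k : ℕ) (lam : ℝ) : ℝ :=
  rk n k * (Real.sin lam / lam ^ (n + 1)) *
    (2 * (nuv n k : ℝ)) ^ (((n : ℝ) + 1) / 2) *
    ∫ t in (0 : ℝ)..(lam / (2 * (nuv n k : ℝ))),
      lagFun n k ((nuv n k : ℝ) * t) * t ^ (((n : ℝ) - 1) / 2)

/-- The Japanese bracket `⟨x⟩ = (1+x²)^{1/2}`. -/
def jap (x : ℝ) : ℝ := Real.sqrt (1 + x ^ 2)

/-- The function `A(t) = (1/2)(arcsin √t + √(t−t²))`. -/
def Afun (t : ℝ) : ℝ := (1 / 2) * (Real.arcsin (Real.sqrt t) + Real.sqrt (t - t ^ 2))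

/-- The Bessel function of the first kind of integer order `m`:
`J_m(x) = Σ_{j=0}^∞ ((−1)^j/(j!(m+j)!)) (x/2)^{2j+m}`. -/
def besselJ (m : ℕ) (x : ℝ) : ℝ :=
  ∑' j : ℕ, ((-1) ^ j / ((j.factorial : ℝ) * ((m + j).factorial : ℝ))) * (x / 2) ^ (2 * j + m)

/-- A Gronwall inequality adapted to coefficients `c / θ ^ 2 + 1 / b`. -/
lemma le_exp_mul_of_deriv_le {E E' : ℝ → ℝ} {α b c r : ℝ} (hα : 0 < α) (hαb : α ≤ b) (hc : 0 ≤ c)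
    (hE : ∀ θ ∈ Set.Icc α b, HasDerivAt E (E' θ) θ) (hEα : 0 ≤ E α)
    (hE0 : 0 ≤ E b)
    (hle : ∀ θ ∈ Set.Icc α b, E' θ ≤ (c / θ ^ 2 + 1 / b) * E θ + r ^ 2 * b) :
    E b ≤ Real.exp (c / α + 1) * (E α + r ^ 2 * b ^ 2) := by
  have hb : 0 < b := hα.trans_le hαb
  set G : ℝ → ℝ := fun θ =>
    E θ * Real.exp (c / θ - θ / b) - r ^ 2 * b * Real.exp (c / α) * θ with hG
  have hderiv : ∀ θ ∈ Set.Icc α b, HasDerivAt G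
      ((E' θ - (c / θ ^ 2 + 1 / b) * E θ) * Real.exp (c / θ - θ / b)
        - r ^ 2 * b * Real.exp (c / α)) θ := by
    intro θ hθ
    have hθ0 : θ ≠ 0 := (hα.trans_le hθ.1).ne'
    have h1 : HasDerivAt (fun θ : ℝ => c / θ - θ / b) (-c / θ ^ 2 - 1 / b) θ := by
      have := (((hasDerivAt_id θ).inv hθ0).const_mul c).sub ((hasDerivAt_id θ).div_const b)
      refine (this.congr_deriv ?_).congr_of_eventuallyEq ?_
      · simp; ring
      · exact Filter.Eventually.of_forall fun y => by simp [div_eq_mul_inv]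
    have h2 := ((hE θ hθ).mul h1.exp).sub ((hasDerivAt_id θ).const_mul (r ^ 2 * b * Real.exp (c / α)))
    refine h2.congr_deriv ?_
    simp
    ring
  have hanti : AntitoneOn G (Set.Icc α b) := by
    refine antitoneOn_of_deriv_nonpos (convex_Icc α b)
      (fun θ hθ => (hderiv θ hθ).continuousAt.continuousWithinAt)
      (fun θ hθ => (hderiv θ (interior_subset hθ)).differentiableAt.differentiableWithinAt) ?_
    intro θ hθ
    have hθ := interior_subset hθ
    have hθ0 : 0 < θ := hα.trans_le hθ.1
    rw [(hderiv θ hθ).deriv]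
    have h1 : E' θ - (c / θ ^ 2 + 1 / b) * E θ ≤ r ^ 2 * b := by linarith [hle θ hθ]
    have h2 : Real.exp (c / θ - θ / b) ≤ Real.exp (c / α) := by
      apply Real.exp_le_exp.2
      have : c / θ ≤ c / α := div_le_div_of_nonneg_left hc hα hθ.1
      have : 0 ≤ θ / b := by positivity
      linarith
    have h3 := mul_le_mul_of_nonneg_right h1 (Real.exp_pos (c / θ - θ / b)).le
    have h4 := mul_le_mul_of_nonneg_left h2 (show 0 ≤ r ^ 2 * b by positivity)
    linarith
  have h := hanti (Set.left_mem_Icc.2 hαb) (Set.right_mem_Icc.2 hαb) hαb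
  simp only [hG] at h
  have h1 : Real.exp (-1) ≤ Real.exp (c / b - b / b) := by
    apply Real.exp_le_exp.2
    rw [div_self hb.ne']
    have : 0 ≤ c / b := by positivity
    linarith
  have h2 : Real.exp (c / α - α / b) ≤ Real.exp (c / α) := by
    apply Real.exp_le_exp.2
    have : 0 ≤ α / b := by positivity
    linarith
  have h3 := mul_le_mul_of_nonneg_left h1 hE0
  have h4 := mul_le_mul_of_nonneg_left h2 hEα
  have h5 : 0 ≤ r ^ 2 * b * Real.exp (c / α) * α := by positivity
  have h6 : E b * Real.exp (-1) ≤ Real.exp (c / α) * (E α + r ^ 2 * b ^ 2) := by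
    nlinarith
  have h7 := mul_le_mul_of_nonneg_right h6 (Real.exp_pos 1).le
  rw [mul_assoc, ← Real.exp_add] at h7
  rw [Real.exp_add]
  simp at h7
  linarith

/-- Energy estimate for a damped oscillator with non-increasing frequency, from a rest point. -/
lemma energy_near {D D1 q κ κ1 R : ℝ → ℝ} {b r : ℝ} (hb : 0 < b)
    (hD : ∀ θ ∈ Set.Ioc 0 b, HasDerivAt D (D1 θ) θ)
    (hD1 : ∀ θ ∈ Set.Ioc 0 b, HasDerivAt D1 (-q θ * D1 θ - κ θ * D θ + R θ) θ)
    (hκ : ∀ θ ∈ Set.Ioc 0 b, HasDerivAt κ (κ1 θ) θ)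
    (hq0 : ∀ θ ∈ Set.Ioc 0 b, 0 ≤ q θ) (hκ0 : ∀ θ ∈ Set.Ioc 0 b, 0 ≤ κ θ)
    (hκ1 : ∀ θ ∈ Set.Ioc 0 b, κ1 θ ≤ 0) (hR : ∀ θ ∈ Set.Ioc 0 b, R θ ^ 2 ≤ r ^ 2)
    (hlim : Filter.Tendsto (fun θ => D1 θ ^ 2 + κ θ * D θ ^ 2) (nhdsWithin 0 (Set.Ioi 0)) (nhds 0)) :
    D1 b ^ 2 + κ b * D b ^ 2 ≤ Real.exp 1 * (r ^ 2 * b ^ 2) := by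
  have key : ∀ α ∈ Set.Ioc 0 b, D1 b ^ 2 + κ b * D b ^ 2 ≤
      Real.exp 1 * ((D1 α ^ 2 + κ α * D α ^ 2) + r ^ 2 * b ^ 2) := by
    intro α hα
    have hsub : ∀ θ ∈ Set.Icc α b, θ ∈ Set.Ioc 0 b := fun θ hθ => ⟨hα.1.trans_le hθ.1, hθ.2⟩
    have hbm : b ∈ Set.Ioc 0 b := ⟨hb, le_rfl⟩
    have h := le_exp_mul_of_deriv_le (E := fun θ => D1 θ ^ 2 + κ θ * D θ ^ 2)
      (E' := fun θ => 2 * D1 θ * (-q θ * D1 θ - κ θ * D θ + R θ) +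
        (κ1 θ * D θ ^ 2 + κ θ * (2 * D θ * D1 θ))) (α := α) (b := b) (c := 0) (r := r)
      hα.1 hα.2 le_rfl ?_ ?_ ?_ ?_
    · simpa using h
    · intro θ hθ
      have hθ := hsub θ hθ
      have := ((hD1 θ hθ).pow 2).add ((hκ θ hθ).mul ((hD θ hθ).pow 2))
      refine this.congr_deriv ?_
      simp
    · have := hκ0 α hα
      positivity
    · have := hκ0 b hbm
      positivity
    · intro θ hθ
      have hθ := hsub θ hθ
      have h1 : 0 ≤ q θ * D1 θ ^ 2 := mul_nonneg (hq0 θ hθ) (sq_nonneg _)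
      have h2 : κ1 θ * D θ ^ 2 ≤ 0 := mul_nonpos_of_nonpos_of_nonneg (hκ1 θ hθ) (sq_nonneg _)
      have h3 : 0 ≤ κ θ * D θ ^ 2 / b :=
        div_nonneg (mul_nonneg (hκ0 θ hθ) (sq_nonneg _)) hb.le
      have h4 : 2 * D1 θ * R θ ≤ D1 θ ^ 2 / b + R θ ^ 2 * b := by
        have : 0 ≤ (D1 θ - b * R θ) ^ 2 / b := by positivity
        have e : (D1 θ - b * R θ) ^ 2 / b = D1 θ ^ 2 / b + R θ ^ 2 * b - 2 * D1 θ * R θ := by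
          field_simp; ring
        linarith
      have h5 := mul_le_mul_of_nonneg_right (hR θ hθ) hb.le
      have e : ((0:ℝ) / θ ^ 2 + 1 / b) * (D1 θ ^ 2 + κ θ * D θ ^ 2) =
        D1 θ ^ 2 / b + κ θ * D θ ^ 2 / b := by ring
      rw [e]
      nlinarith
  have hlim2 : Filter.Tendsto (fun α => Real.exp 1 * ((D1 α ^ 2 + κ α * D α ^ 2) + r ^ 2 * b ^ 2))
      (nhdsWithin 0 (Set.Ioi 0)) (nhds (Real.exp 1 * (0 + r ^ 2 * b ^ 2))) :=
    (hlim.add_const _).const_mul _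
  rw [zero_add] at hlim2
  exact ge_of_tendsto hlim2 (Filter.mem_of_superset (Ioc_mem_nhdsGT hb) key)

/-- Weighted energy estimate, giving the decay of an oscillator with damping `q`;
the weight `S` is an integrating factor of `q`. -/
lemma energy_far {D D1 q q1 κ κ1 R S : ℝ → ℝ} {α b r ν c : ℝ} (hα : 0 < α) (hαb : α ≤ b)
    (hν : 0 < ν) (hc : 0 ≤ c) (hνα : 1 ≤ ν * α)
    (hD : ∀ θ ∈ Set.Icc α b, HasDerivAt D (D1 θ) θ)
    (hD1 : ∀ θ ∈ Set.Icc α b, HasDerivAt D1 (-q θ * D1 θ - κ θ * D θ + R θ) θ)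
    (hq : ∀ θ ∈ Set.Icc α b, HasDerivAt q (q1 θ) θ)
    (hκ : ∀ θ ∈ Set.Icc α b, HasDerivAt κ (κ1 θ) θ)
    (hS : ∀ θ ∈ Set.Icc α b, HasDerivAt S (q θ * S θ) θ)
    (hS0 : ∀ θ ∈ Set.Icc α b, 0 ≤ S θ) (hκ0 : ∀ θ ∈ Set.Icc α b, ν ^ 2 / 4 ≤ κ θ)
    (hκ1 : ∀ θ ∈ Set.Icc α b, κ1 θ ≤ 0)
    (hV : ∀ θ ∈ Set.Icc α b, |q θ ^ 2 / 4 + q1 θ / 2| ≤ c / θ ^ 2)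
    (hR : ∀ θ ∈ Set.Icc α b, S θ * R θ ^ 2 ≤ r ^ 2) :
    S b * ((D1 b + q b / 2 * D b) ^ 2 + κ b * D b ^ 2) ≤
      Real.exp (2 * c + 1) *
        (S α * ((D1 α + q α / 2 * D α) ^ 2 + κ α * D α ^ 2) + r ^ 2 * b ^ 2) := by
  have hb : 0 < b := hα.trans_le hαb
  have hnn : ∀ θ ∈ Set.Icc α b, 0 ≤ S θ * ((D1 θ + q θ / 2 * D θ) ^ 2 + κ θ * D θ ^ 2) := by
    intro θ hθ
    have h1 := hS0 θ hθ
    have h2 : 0 ≤ κ θ := le_trans (by positivity) (hκ0 θ hθ)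
    positivity
  have h := le_exp_mul_of_deriv_le
    (E := fun θ => S θ * ((D1 θ + q θ / 2 * D θ) ^ 2 + κ θ * D θ ^ 2))
    (E' := fun θ => S θ * (2 * (D1 θ + q θ / 2 * D θ) *
      ((q θ ^ 2 / 4 + q1 θ / 2) * D θ + R θ) + κ1 θ * D θ ^ 2))
    (α := α) (b := b) (c := 2 * c / ν) (r := r) hα hαb (by positivity) ?_
    (hnn α (Set.left_mem_Icc.2 hαb)) (hnn b (Set.right_mem_Icc.2 hαb)) ?_
  · refine h.trans (mul_le_mul_of_nonneg_right (Real.exp_le_exp.2 ?_) ?_)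
    · have : 2 * c / ν / α ≤ 2 * c := by
        rw [div_div, div_le_iff₀ (by positivity)]
        nlinarith
      linarith
    · have := hnn α (Set.left_mem_Icc.2 hαb)
      positivity
  · intro θ hθ
    have := (hS θ hθ).mul ((((hD1 θ hθ).add (((hq θ hθ).div_const 2).mul (hD θ hθ))).pow 2).add
      ((hκ θ hθ).mul ((hD θ hθ).pow 2)))
    refine this.congr_deriv ?_
    simp
    ring
  · intro θ hθ
    have hθ0 : 0 < θ := hα.trans_le hθ.1
    set Z := D1 θ + q θ / 2 * D θ with hZ
    set V := q θ ^ 2 / 4 + q1 θ / 2 with hVdef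
    have hZD : |2 * Z * D θ| ≤ 2 / ν * (Z ^ 2 + κ θ * D θ ^ 2) := by
      have h1 : ν ^ 2 / 4 * D θ ^ 2 ≤ κ θ * D θ ^ 2 :=
        mul_le_mul_of_nonneg_right (hκ0 θ hθ) (sq_nonneg _)
      rw [div_mul_eq_mul_div, le_div_iff₀ hν, show |2 * Z * D θ| * ν = |2 * Z * D θ * ν| by
        rw [abs_mul _ ν, abs_of_pos hν], abs_le]
      constructor <;> nlinarith [sq_nonneg (Z - ν / 2 * D θ), sq_nonneg (Z + ν / 2 * D θ)]
    have h1 : 2 * Z * (V * D θ) ≤ 2 * c / ν / θ ^ 2 * (Z ^ 2 + κ θ * D θ ^ 2) := by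
      calc 2 * Z * (V * D θ) ≤ |V * (2 * Z * D θ)| := by
            rw [show 2 * Z * (V * D θ) = V * (2 * Z * D θ) by ring]; exact le_abs_self _
        _ = |V| * |2 * Z * D θ| := abs_mul _ _
        _ ≤ c / θ ^ 2 * (2 / ν * (Z ^ 2 + κ θ * D θ ^ 2)) :=
            mul_le_mul (hV θ hθ) hZD (abs_nonneg _) (by positivity)
        _ = _ := by ring
    have h2 : κ1 θ * D θ ^ 2 ≤ 0 := mul_nonpos_of_nonpos_of_nonneg (hκ1 θ hθ) (sq_nonneg _)
    have hk : 0 ≤ κ θ := le_trans (by positivity) (hκ0 θ hθ)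
    have h3 : 0 ≤ κ θ * D θ ^ 2 / b := by positivity
    have h4 : 2 * Z * R θ ≤ Z ^ 2 / b + R θ ^ 2 * b := by
      have : 0 ≤ (Z - b * R θ) ^ 2 / b := by positivity
      have e : (Z - b * R θ) ^ 2 / b = Z ^ 2 / b + R θ ^ 2 * b - 2 * Z * R θ := by
        field_simp; ring
      linarith
    have h5 := mul_le_mul_of_nonneg_right (hR θ hθ) hb.le
    have h6 : 2 * Z * (V * D θ + R θ) + κ1 θ * D θ ^ 2 ≤
        (2 * c / ν / θ ^ 2 + 1 / b) * (Z ^ 2 + κ θ * D θ ^ 2) + R θ ^ 2 * b := by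
      have e : (2 * c / ν / θ ^ 2 + 1 / b) * (Z ^ 2 + κ θ * D θ ^ 2) =
        2 * c / ν / θ ^ 2 * (Z ^ 2 + κ θ * D θ ^ 2) + (Z ^ 2 / b + κ θ * D θ ^ 2 / b) := by ring
      rw [e]
      nlinarith
    have h7 := mul_le_mul_of_nonneg_left h6 (hS0 θ hθ)
    show S θ * (2 * Z * (V * D θ + R θ) + κ1 θ * D θ ^ 2) ≤ (2 * c / ν / θ ^ 2 + 1 / b) * (S θ * (Z ^ 2 + κ θ * D θ ^ 2)) + r ^ 2 * b
    nlinarith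

/-- The entire function `∑ (-1)^j s^j / (j! (m+j)!)`, so that
`J_m(x) = (x / 2) ^ m * besselAux m (x ^ 2 / 4)`. -/
def besselAux (m : ℕ) (s : ℝ) : ℝ :=
  ∑' j : ℕ, ((-1) ^ j / ((j.factorial : ℝ) * ((m + j).factorial : ℝ))) * s ^ j

lemma besselJ_eq (m : ℕ) (x : ℝ) : besselJ m x = (x / 2) ^ m * besselAux m (x ^ 2 / 4) := by
  unfold besselJ besselAux
  rw [← tsum_mul_left]
  refine tsum_congr fun j => ?_
  rw [pow_add, pow_mul, show (x / 2) ^ 2 = x ^ 2 / 4 by ring]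
  ring

lemma abs_besselAux_coeff_le (m j : ℕ) :
    |(-1 : ℝ) ^ j / ((j.factorial : ℝ) * ((m + j).factorial : ℝ))| ≤ 1 / (j.factorial : ℝ) := by
  rw [abs_div, abs_pow, abs_neg, abs_one, one_pow, abs_of_pos (by positivity)]
  apply one_div_le_one_div_of_le (by positivity)
  have : (1 : ℝ) ≤ ((m + j).factorial : ℝ) := by exact_mod_cast (m + j).factorial_pos
  exact le_mul_of_one_le_right (by positivity) this

lemma summable_besselAux (m : ℕ) (s : ℝ) :
    Summable fun j : ℕ => ((-1 : ℝ) ^ j / ((j.factorial : ℝ) * ((m + j).factorial : ℝ))) * s ^ j := by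
  refine Summable.of_norm_bounded (g := fun j => |s| ^ j / (j.factorial : ℝ))
    (Real.summable_pow_div_factorial _) fun j => ?_
  rw [Real.norm_eq_abs, abs_mul, abs_pow]
  calc _ ≤ 1 / (j.factorial : ℝ) * |s| ^ j :=
        mul_le_mul_of_nonneg_right (abs_besselAux_coeff_le m j) (by positivity)
    _ = _ := by ring

lemma hasDerivAt_besselAux (m : ℕ) (s : ℝ) :
    HasDerivAt (besselAux m) (-besselAux (m + 1) s) s := by
  set r : ℝ := |s| + 1
  have hr : 0 ≤ r := by positivity
  have hu : Summable fun j : ℕ => (j : ℝ) * r ^ (j - 1) / (j.factorial : ℝ) := by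
    rw [← summable_nat_add_iff 1]
    refine (Real.summable_pow_div_factorial r).congr fun j => ?_
    rw [Nat.factorial_succ]
    push_cast
    field_simp
  have h := hasDerivAt_tsum_of_isPreconnected (𝕜 := ℝ) (t := Metric.ball (0 : ℝ) r)
    (g := fun (j : ℕ) y => ((-1 : ℝ) ^ j / ((j.factorial : ℝ) * ((m + j).factorial : ℝ))) * y ^ j)
    (g' := fun (j : ℕ) y =>
      ((-1 : ℝ) ^ j / ((j.factorial : ℝ) * ((m + j).factorial : ℝ))) * (j * y ^ (j - 1)))
    (y₀ := 0) (y := s) hu Metric.isOpen_ball (convex_ball _ _).isPreconnected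
    (fun j y _ => (hasDerivAt_pow j y).const_mul _) ?_ (by simp [r]; positivity)
    (summable_besselAux m 0) (by simp [r])
  · refine h.congr_deriv ?_
    have hs : Summable fun j : ℕ =>
        ((-1 : ℝ) ^ j / ((j.factorial : ℝ) * ((m + j).factorial : ℝ))) * (j * s ^ (j - 1)) := by
      rw [← summable_nat_add_iff 1]
      refine (summable_besselAux (m + 1) s).neg.congr fun j => ?_
      rw [Nat.factorial_succ, show m + (j + 1) = m + 1 + j by ring]
      push_cast
      field_simp
      simp [pow_succ]
      ring
    rw [hs.tsum_eq_zero_add, besselAux, ← tsum_neg]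
    simp only [Nat.cast_zero, zero_mul, mul_zero, zero_add]
    refine tsum_congr fun j => ?_
    rw [Nat.factorial_succ, show m + (j + 1) = m + 1 + j by ring]
    push_cast
    field_simp
    simp [pow_succ]
    ring
  · intro j y hy
    rw [Metric.mem_ball, dist_zero_right, Real.norm_eq_abs] at hy
    rw [Real.norm_eq_abs, abs_mul, abs_mul, abs_pow, Nat.abs_cast]
    calc _ ≤ 1 / (j.factorial : ℝ) * (j * r ^ (j - 1)) := by
          gcongr
          exact abs_besselAux_coeff_le m j
      _ = _ := by ring

lemma besselAux_recurrence (m : ℕ) (s : ℝ) :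
    s * besselAux (m + 2) s = (m + 1) * besselAux (m + 1) s - besselAux m s := by
  unfold besselAux
  rw [← tsum_mul_left, ← tsum_mul_left,
    ← ((summable_besselAux (m + 1) s).mul_left _).tsum_sub (summable_besselAux m s)]
  rw [(((summable_besselAux (m + 1) s).mul_left _).sub (summable_besselAux m s)).tsum_eq_zero_add]
  have h0 : ((m : ℝ) + 1) * ((-1) ^ 0 / (((Nat.factorial 0 : ℕ) : ℝ) * ((m + 1 + 0).factorial : ℝ)) * s ^ 0) -
      (-1) ^ 0 / (((Nat.factorial 0 : ℕ) : ℝ) * ((m + 0).factorial : ℝ)) * s ^ 0 = 0 := by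
    simp only [add_zero, Nat.factorial_succ]
    push_cast
    have : (m.factorial : ℝ) ≠ 0 := by positivity
    field_simp
    simp
  rw [h0, zero_add]
  refine tsum_congr fun j => ?_
  rw [show m + 1 + (j + 1) = (m + j + 1) + 1 by ring, show m + (j + 1) = m + j + 1 by ring,
    show m + 2 + j = (m + j + 1) + 1 by ring, Nat.factorial_succ (m + j + 1), Nat.factorial_succ j]
  push_cast
  have : ((m + j + 1).factorial : ℝ) ≠ 0 := by positivity
  have : (m : ℝ) + j + 1 + 1 ≠ 0 := by positivity
  field_simp
  ring

lemma besselAux_zero (m : ℕ) : besselAux m 0 = 1 / (m.factorial : ℝ) := by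
  unfold besselAux
  rw [tsum_eq_single 0]
  · simp
  · intro j hj; simp [hj]

/-- `x ↦ (x / 2) ^ (-m) J_m(x)`. -/
def besselReg (m : ℕ) (x : ℝ) : ℝ := besselAux m (x ^ 2 / 4)

lemma hasDerivAt_besselReg (m : ℕ) (x : ℝ) :
    HasDerivAt (besselReg m) (-(x / 2) * besselReg (m + 1) x) x := by
  have h := (hasDerivAt_besselAux m (x ^ 2 / 4)).comp x (((hasDerivAt_id x).pow 2).div_const 4)
  refine h.congr_deriv ?_
  simp [besselReg]
  ring

lemma hasDerivAt_deriv_besselReg (m : ℕ) (x : ℝ) :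
    HasDerivAt (fun x => -(x / 2) * besselReg (m + 1) x)
      ((m + 1 / 2) * besselReg (m + 1) x - besselReg m x) x := by
  have h := ((hasDerivAt_id x).div_const 2).neg.mul (hasDerivAt_besselReg (m + 1) x)
  refine h.congr_deriv ?_
  have := besselAux_recurrence m (x ^ 2 / 4)
  simp only [besselReg, id, Pi.neg_apply]
  linear_combination this

lemma besselReg_decay (m : ℕ) :
    ∃ C : ℝ, 0 < C ∧ ∀ x, 0 ≤ x → besselReg m x ^ 2 * (1 + x) ^ (2 * m + 1) ≤ C := by
  have hcont : Continuous (besselReg m) :=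
    continuous_iff_continuousAt.2 fun x => (hasDerivAt_besselReg m x).continuousAt
  obtain ⟨B, hB⟩ := (isCompact_Icc (a := (0 : ℝ)) (b := 1)).exists_bound_of_continuousOn
    hcont.continuousOn
  set p : ℝ := 2 * m + 1 with hp
  set E1 : ℝ := (-(1 / 2) * besselReg (m + 1) 1 + p / 2 * besselReg m 1) ^ 2 + besselReg m 1 ^ 2
  set C1 : ℝ := Real.exp (2 * p ^ 2 + 1) * E1
  refine ⟨2 ^ (2 * m + 1) * (B ^ 2 + C1) + 1, by positivity, fun x hx => ?_⟩
  have hC1 : 0 ≤ C1 := by positivity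
  rcases le_total x 1 with h1 | h1
  · have h2 : besselReg m x ^ 2 ≤ B ^ 2 := by
      rw [← sq_abs]
      have := hB x ⟨hx, h1⟩
      rw [Real.norm_eq_abs] at this
      gcongr
    have h3 : (1 + x) ^ (2 * m + 1) ≤ 2 ^ (2 * m + 1) := by
      gcongr; linarith
    calc _ ≤ B ^ 2 * 2 ^ (2 * m + 1) := by gcongr
      _ ≤ _ := by nlinarith [show (0:ℝ) < 2 ^ (2 * m + 1) by positivity]
  · have h := energy_far (D := besselReg m) (D1 := fun x => -(x / 2) * besselReg (m + 1) x)
      (q := fun x => p / x) (q1 := fun x => -p / x ^ 2) (κ := fun _ => 1) (κ1 := fun _ => 0)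
      (R := fun _ => 0) (S := fun x => x ^ (2 * m + 1)) (α := 1) (b := x) (r := 0) (ν := 1)
      (c := p ^ 2) one_pos h1 one_pos (by positivity) (by norm_num)
      (fun θ _ => hasDerivAt_besselReg m θ) ?_ ?_ (fun θ _ => hasDerivAt_const θ 1) ?_ ?_
      (fun θ _ => by norm_num) (fun θ _ => le_rfl) ?_ (fun θ _ => by simp)
    · simp only [one_pow, one_mul, div_one, zero_pow two_ne_zero, zero_mul, add_zero] at h
      have h2 : besselReg m x ^ 2 * x ^ (2 * m + 1) ≤ C1 := by
        refine le_trans ?_ h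
        have : 0 ≤ x ^ (2 * m + 1) := by positivity
        nlinarith [mul_nonneg this (sq_nonneg (-(x / 2) * besselReg (m + 1) x + p / x / 2 * besselReg m x))]
      calc _ ≤ besselReg m x ^ 2 * (2 * x) ^ (2 * m + 1) := by
            gcongr; linarith
        _ = 2 ^ (2 * m + 1) * (besselReg m x ^ 2 * x ^ (2 * m + 1)) := by rw [mul_pow]; ring
        _ ≤ 2 ^ (2 * m + 1) * C1 := by gcongr
        _ ≤ _ := by nlinarith [show (0:ℝ) < 2 ^ (2 * m + 1) * B ^ 2 + 1 by positivity]
    · intro θ hθ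
      have hθ0 : 0 < θ := one_pos.trans_le hθ.1
      refine (hasDerivAt_deriv_besselReg m θ).congr_deriv ?_
      rw [hp]; field_simp; ring
    · intro θ hθ
      have hθ0 : 0 < θ := one_pos.trans_le hθ.1
      have := (hasDerivAt_inv hθ0.ne').const_mul p
      refine this.congr_deriv ?_
      ring
    · intro θ hθ
      have hθ0 : 0 < θ := one_pos.trans_le hθ.1
      refine (hasDerivAt_pow (2 * m + 1) θ).congr_deriv ?_
      rw [hp]; push_cast; field_simp; simp [pow_succ]
    · intro θ hθ
      have hθ0 : 0 < θ := one_pos.trans_le hθ.1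
      positivity
    · intro θ hθ
      have hθ0 : 0 < θ := one_pos.trans_le hθ.1
      have hp1 : 1 ≤ p := by rw [hp]; linarith [show (0:ℝ) ≤ m by positivity]
      rw [show (p / θ) ^ 2 / 4 + -p / θ ^ 2 / 2 = (p ^ 2 / 4 - p / 2) / θ ^ 2 by ring, abs_div,
        abs_of_pos (show 0 < θ ^ 2 by positivity)]
      gcongr
      rw [abs_le]; constructor <;> nlinarith

/-- `A(sin² θ)`. -/
def phase (θ : ℝ) : ℝ := (θ + Real.sin θ * Real.cos θ) / 2

lemma hasDerivAt_phase (θ : ℝ) : HasDerivAt phase (Real.cos θ ^ 2) θ := by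
  have h := ((hasDerivAt_id θ).add ((Real.hasDerivAt_sin θ).mul (Real.hasDerivAt_cos θ))).div_const 2
  refine h.congr_deriv ?_
  linear_combination (-1 / 2) * (Real.sin_sq_add_cos_sq θ)

lemma lt_one_of_mem {θ : ℝ} (h : θ ∈ Set.Ioc 0 (Real.pi / 4)) : θ < 1 := by
  have := h.2
  have := Real.pi_lt_four
  linarith

lemma half_le_sin {θ : ℝ} (h : θ ∈ Set.Ioc 0 (Real.pi / 4)) : θ / 2 ≤ Real.sin θ := by
  have h1 := lt_one_of_mem h
  have h2 := Real.sin_ge_sub_cube h.1.le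
  have h3 : θ ^ 3 ≤ θ := by
    have := mul_le_mul_of_nonneg_left (show θ ^ 2 ≤ 1 by nlinarith [h.1]) h.1.le
    nlinarith
  linarith [h.1]

lemma sin_pos_of_mem {θ : ℝ} (h : θ ∈ Set.Ioc 0 (Real.pi / 4)) : 0 < Real.sin θ := by
  have := half_le_sin h
  have := h.1
  linarith

lemma half_le_cos_sq {θ : ℝ} (h : θ ∈ Set.Ioc 0 (Real.pi / 4)) : 1 / 2 ≤ Real.cos θ ^ 2 := by
  have h1 : 0 ≤ Real.cos (2 * θ) :=
    Real.cos_nonneg_of_neg_pi_div_two_le_of_le (by linarith [h.1, Real.pi_pos]) (by linarith [h.2])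
  rw [Real.cos_two_mul] at h1
  linarith

lemma cos_pos_of_mem {θ : ℝ} (h : θ ∈ Set.Ioc 0 (Real.pi / 4)) : 0 < Real.cos θ :=
  Real.cos_pos_of_mem_Ioo ⟨by linarith [h.1, Real.pi_pos], by linarith [h.2, Real.pi_pos]⟩

lemma half_le_cos {θ : ℝ} (h : θ ∈ Set.Ioc 0 (Real.pi / 4)) : 1 / 2 ≤ Real.cos θ := by
  nlinarith [half_le_cos_sq h, cos_pos_of_mem h, Real.cos_le_one θ]

lemma sub_sin_mul_cos_mem {θ : ℝ} (h : θ ∈ Set.Ioc 0 (Real.pi / 4)) :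
    0 ≤ θ - Real.sin θ * Real.cos θ ∧ θ - Real.sin θ * Real.cos θ ≤ θ ^ 3 := by
  have h2 := Real.sin_ge_sub_cube h.1.le
  have h3 := Real.one_sub_sq_div_two_le_cos (x := θ)
  have h4 := Real.sin_le h.1.le
  have h5 := Real.cos_le_one θ
  have h6 := sin_pos_of_mem h
  have h0 := h.1
  constructor
  · nlinarith
  · have : Real.sin θ * (1 - Real.cos θ) ≤ θ * (θ ^ 2 / 2) :=
      mul_le_mul h4 (by linarith) (by linarith) h0.le
    nlinarith [pow_pos h0 3]

lemma phase_bounds {θ : ℝ} (h : θ ∈ Set.Ioc 0 (Real.pi / 4)) : θ / 2 ≤ phase θ ∧ phase θ ≤ θ := by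
  have h1 := sub_sin_mul_cos_mem h
  have h2 := mul_pos (sin_pos_of_mem h) (cos_pos_of_mem h)
  unfold phase
  constructor <;> linarith

lemma phase_pos {θ : ℝ} (h : θ ∈ Set.Ioc 0 (Real.pi / 4)) : 0 < phase θ := by
  have := (phase_bounds h).1
  have := h.1
  linarith

lemma tan_le_of_mem {θ : ℝ} (h : θ ∈ Set.Ioc 0 (Real.pi / 4)) :
    Real.sin θ / Real.cos θ ≤ 2 * θ := by
  rw [div_le_iff₀ (cos_pos_of_mem h)]
  have := Real.sin_le h.1.le
  nlinarith [half_le_cos h, h.1]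

/-- The damping coefficient of the Laguerre equation in the variable `θ`, `t = sin² θ`. -/
def damping (p θ : ℝ) : ℝ := p * (Real.cos θ / Real.sin θ) + Real.sin θ / Real.cos θ

/-- The derivative of `damping`. -/
def damping' (p θ : ℝ) : ℝ := -p / Real.sin θ ^ 2 + 1 / Real.cos θ ^ 2

/-- Logarithmic derivative of `phase / sin`. -/
def phaseLog (θ : ℝ) : ℝ := Real.cos θ ^ 2 / phase θ - Real.cos θ / Real.sin θ

/-- The derivative of `phaseLog`. -/
def phaseLog' (θ : ℝ) : ℝ :=
  -2 * Real.cos θ * Real.sin θ / phase θ - Real.cos θ ^ 4 / phase θ ^ 2 + 1 / Real.sin θ ^ 2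

/-- Logarithmic derivative of the Liouville–Green amplitude. -/
def ampLog (p θ : ℝ) : ℝ := (p * phaseLog θ + Real.sin θ / Real.cos θ) / 2

/-- The derivative of `ampLog`. -/
def ampLog' (p θ : ℝ) : ℝ := (p * phaseLog' θ + 1 / Real.cos θ ^ 2) / 2

/-- The Liouville–Green amplitude `((A / sin θ) ^ p / cos θ) ^ (1/2)`. -/
def amp (p θ : ℝ) : ℝ :=
  Real.exp ((p * (Real.log (phase θ) - Real.log (Real.sin θ)) - Real.log (Real.cos θ)) / 2)

lemma hasDerivAt_tan_quot {θ : ℝ} (h : θ ∈ Set.Ioc 0 (Real.pi / 4)) :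
    HasDerivAt (fun θ => Real.sin θ / Real.cos θ) (1 / Real.cos θ ^ 2) θ := by
  have hc := (cos_pos_of_mem h).ne'
  refine ((Real.hasDerivAt_sin θ).div (Real.hasDerivAt_cos θ) hc).congr_deriv ?_
  congr 1
  linear_combination Real.sin_sq_add_cos_sq θ

lemma hasDerivAt_cot_quot {θ : ℝ} (h : θ ∈ Set.Ioc 0 (Real.pi / 4)) :
    HasDerivAt (fun θ => Real.cos θ / Real.sin θ) (-1 / Real.sin θ ^ 2) θ := by
  have hc := (sin_pos_of_mem h).ne'
  refine ((Real.hasDerivAt_cos θ).div (Real.hasDerivAt_sin θ) hc).congr_deriv ?_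
  congr 1
  linear_combination -Real.sin_sq_add_cos_sq θ

lemma hasDerivAt_damping {p θ : ℝ} (h : θ ∈ Set.Ioc 0 (Real.pi / 4)) :
    HasDerivAt (damping p) (damping' p θ) θ := by
  refine (((hasDerivAt_cot_quot h).const_mul p).add (hasDerivAt_tan_quot h)).congr_deriv ?_
  rw [damping']; ring

lemma hasDerivAt_phaseLog {θ : ℝ} (h : θ ∈ Set.Ioc 0 (Real.pi / 4)) :
    HasDerivAt phaseLog (phaseLog' θ) θ := by
  have hp := (phase_pos h).ne'
  refine ((((Real.hasDerivAt_cos θ).pow 2).div (hasDerivAt_phase θ) hp).sub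
    (hasDerivAt_cot_quot h)).congr_deriv ?_
  have hs := (sin_pos_of_mem h).ne'
  rw [phaseLog']
  simp
  field_simp
  ring

lemma hasDerivAt_ampLog {p θ : ℝ} (h : θ ∈ Set.Ioc 0 (Real.pi / 4)) :
    HasDerivAt (ampLog p) (ampLog' p θ) θ :=
  (((hasDerivAt_phaseLog h).const_mul p).add (hasDerivAt_tan_quot h)).div_const 2

lemma hasDerivAt_amp {p θ : ℝ} (h : θ ∈ Set.Ioc 0 (Real.pi / 4)) :
    HasDerivAt (amp p) (amp p θ * ampLog p θ) θ := by
  have hp := (phase_pos h).ne'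
  have hs := (sin_pos_of_mem h).ne'
  have hc := (cos_pos_of_mem h).ne'
  have h1 := (((((hasDerivAt_phase θ).log hp).sub ((Real.hasDerivAt_sin θ).log hs)).const_mul p).sub
    ((Real.hasDerivAt_cos θ).log hc)).div_const 2
  refine h1.exp.congr_deriv ?_
  simp only [amp, ampLog, phaseLog, Pi.sub_apply]
  ring

lemma damping_nonneg {p θ : ℝ} (hp : 0 ≤ p) (h : θ ∈ Set.Ioc 0 (Real.pi / 4)) :
    0 ≤ damping p θ := by
  have hs := sin_pos_of_mem h
  have hc := cos_pos_of_mem h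
  unfold damping
  positivity

lemma damping_le {p θ : ℝ} (hp : 0 ≤ p) (h : θ ∈ Set.Ioc 0 (Real.pi / 4)) :
    damping p θ ≤ (2 * p + 2) / θ := by
  have hs := sin_pos_of_mem h
  have hc := cos_pos_of_mem h
  have h0 := h.1
  have h1 : Real.cos θ / Real.sin θ ≤ 2 / θ := by
    rw [div_le_div_iff₀ hs h0]
    nlinarith [half_le_sin h, Real.cos_le_one θ]
  have h2 : 2 * θ ≤ 2 / θ := by
    rw [le_div_iff₀ h0]
    nlinarith [lt_one_of_mem h]
  have h3 := tan_le_of_mem h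
  have h4 := mul_le_mul_of_nonneg_left h1 hp
  have e : (2 * p + 2) / θ = p * (2 / θ) + 2 / θ := by ring
  unfold damping
  linarith

lemma inv_cos_sq_le {θ : ℝ} (h : θ ∈ Set.Ioc 0 (Real.pi / 4)) : 1 / Real.cos θ ^ 2 ≤ 2 := by
  have hc := cos_pos_of_mem h
  rw [div_le_iff₀ (by positivity)]
  linarith [half_le_cos_sq h]

lemma abs_potential_le {p θ : ℝ} (hp : 0 ≤ p) (h : θ ∈ Set.Ioc 0 (Real.pi / 4)) :
    |damping p θ ^ 2 / 4 + damping' p θ / 2| ≤ ((p + 1) ^ 2 + 2 * p + 1) / θ ^ 2 := by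
  have hs := sin_pos_of_mem h
  have hc := cos_pos_of_mem h
  have h0 := h.1
  have h1 := damping_le hp h
  have h2 := damping_nonneg hp h
  have h3 : damping p θ ^ 2 ≤ ((2 * p + 2) / θ) ^ 2 := by gcongr
  have h4 := inv_cos_sq_le h
  have h4' : 0 ≤ 1 / Real.cos θ ^ 2 := by positivity
  have h5 : 1 / Real.sin θ ^ 2 ≤ 4 / θ ^ 2 := by
    rw [div_le_div_iff₀ (by positivity) (by positivity)]
    nlinarith [half_le_sin h]
  have h5' : 0 ≤ 1 / Real.sin θ ^ 2 := by positivity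
  have h6 : 1 ≤ 1 / θ ^ 2 := by
    rw [le_div_iff₀ (by positivity)]
    nlinarith [lt_one_of_mem h]
  have h7 := mul_le_mul_of_nonneg_left h5 hp
  have h8 := mul_nonneg hp h5'
  have e1 : ((2 * p + 2) / θ) ^ 2 = 4 * ((p + 1) ^ 2 * (1 / θ ^ 2)) := by ring
  have e2 : ((p + 1) ^ 2 + 2 * p + 1) / θ ^ 2 =
    (p + 1) ^ 2 * (1 / θ ^ 2) + p * (4 / θ ^ 2) / 2 + 1 / θ ^ 2 := by ring
  have e3 : damping' p θ = - (p * (1 / Real.sin θ ^ 2)) + 1 / Real.cos θ ^ 2 := by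
    unfold damping'; ring
  have h9 : 0 ≤ (p + 1) ^ 2 * (1 / θ ^ 2) := by positivity
  rw [e2, e3, abs_le]
  constructor <;> nlinarith [sq_nonneg (damping p θ)]

lemma abs_phaseLog_le {θ : ℝ} (h : θ ∈ Set.Ioc 0 (Real.pi / 4)) : |phaseLog θ| ≤ 2 * θ := by
  have hs := sin_pos_of_mem h
  have hc := cos_pos_of_mem h
  have hp := phase_pos h
  have h0 := h.1
  have h1 := sub_sin_mul_cos_mem h
  have e : phaseLog θ = -(Real.cos θ * (θ - Real.sin θ * Real.cos θ) /
      (2 * (phase θ * Real.sin θ))) := by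
    have : 2 * phase θ = θ + Real.sin θ * Real.cos θ := by unfold phase; ring
    unfold phaseLog
    field_simp
    linear_combination -this
  rw [e, abs_neg, abs_of_nonneg (div_nonneg (mul_nonneg hc.le h1.1) (by positivity)),
    div_le_iff₀ (by positivity)]
  have h2 : θ / 2 * (θ / 2) ≤ phase θ * Real.sin θ :=
    mul_le_mul (phase_bounds h).1 (half_le_sin h) (by positivity) hp.le
  have h3 : Real.cos θ * (θ - Real.sin θ * Real.cos θ) ≤ 1 * θ ^ 3 :=
    mul_le_mul (Real.cos_le_one θ) h1.2 h1.1 zero_le_one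
  nlinarith

lemma abs_phaseLog'_le {θ : ℝ} (h : θ ∈ Set.Ioc 0 (Real.pi / 4)) : |phaseLog' θ| ≤ 36 := by
  have hs := sin_pos_of_mem h
  have hc := cos_pos_of_mem h
  have hp := phase_pos h
  have h0 := h.1
  have h1 := sub_sin_mul_cos_mem h
  have hc1 := Real.cos_le_one θ
  have hs1 := Real.sin_le h0.le
  set d := phase θ - Real.cos θ ^ 2 * Real.sin θ with hd
  have e : phaseLog' θ = -(2 * Real.cos θ * Real.sin θ / phase θ) +
      d * (phase θ + Real.cos θ ^ 2 * Real.sin θ) / (phase θ ^ 2 * Real.sin θ ^ 2) := by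
    unfold phaseLog'
    rw [hd]
    field_simp
    ring
  have hd1 : d = (θ - Real.sin θ * Real.cos θ) / 2 + Real.sin θ * Real.cos θ * (1 - Real.cos θ) := by
    rw [hd, phase]; ring
  have hd2 : 0 ≤ Real.sin θ * Real.cos θ * (1 - Real.cos θ) :=
    mul_nonneg (by positivity) (by linarith)
  have hd3 : Real.sin θ * Real.cos θ * (1 - Real.cos θ) ≤ θ * (θ ^ 2 / 2) := by
    refine mul_le_mul ?_ (by linarith [Real.one_sub_sq_div_two_le_cos (x := θ)]) (by linarith) h0.le
    nlinarith
  have hd4 : 0 ≤ d := by rw [hd1]; linarith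
  have hd5 : d ≤ θ ^ 3 := by rw [hd1]; nlinarith
  have h2 : θ / 2 * (θ / 2) ≤ phase θ * Real.sin θ :=
    mul_le_mul (phase_bounds h).1 (half_le_sin h) (by positivity) hp.le
  have h3 : (θ / 2 * (θ / 2)) ^ 2 ≤ phase θ ^ 2 * Real.sin θ ^ 2 := by
    rw [← mul_pow]; gcongr
  have h4 : phase θ + Real.cos θ ^ 2 * Real.sin θ ≤ 2 * θ := by
    have : Real.cos θ ^ 2 * Real.sin θ ≤ 1 * θ :=
      mul_le_mul (by nlinarith) hs1 hs.le zero_le_one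
    linarith [(phase_bounds h).2]
  have h5 : d * (phase θ + Real.cos θ ^ 2 * Real.sin θ) / (phase θ ^ 2 * Real.sin θ ^ 2) ≤ 32 := by
    rw [div_le_iff₀ (by positivity)]
    have := mul_le_mul hd5 h4 (by positivity) (by positivity)
    nlinarith
  have h6 : 0 ≤ d * (phase θ + Real.cos θ ^ 2 * Real.sin θ) / (phase θ ^ 2 * Real.sin θ ^ 2) := by
    positivity
  have h7 : 2 * Real.cos θ * Real.sin θ / phase θ ≤ 4 := by
    rw [div_le_iff₀ hp]
    nlinarith [(phase_bounds h).1]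
  have h8 : 0 ≤ 2 * Real.cos θ * Real.sin θ / phase θ := by positivity
  rw [e, abs_le]
  constructor <;> linarith

lemma abs_ampLog_le {p θ : ℝ} (hp : 0 ≤ p) (h : θ ∈ Set.Ioc 0 (Real.pi / 4)) :
    |ampLog p θ| ≤ (p + 1) * θ := by
  have hs := sin_pos_of_mem h
  have hc := cos_pos_of_mem h
  have h1 := abs_le.1 (abs_phaseLog_le h)
  have h2 := tan_le_of_mem h
  have h3 : 0 ≤ Real.sin θ / Real.cos θ := by positivity
  have h4 := mul_le_mul_of_nonneg_left h1.1 hp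
  have h5 := mul_le_mul_of_nonneg_left h1.2 hp
  unfold ampLog
  rw [abs_le]
  constructor <;> nlinarith [h.1]

lemma abs_ampLog'_le {p θ : ℝ} (hp : 0 ≤ p) (h : θ ∈ Set.Ioc 0 (Real.pi / 4)) :
    |ampLog' p θ| ≤ 18 * p + 1 := by
  have hc := cos_pos_of_mem h
  have h1 := abs_le.1 (abs_phaseLog'_le h)
  have h2 := inv_cos_sq_le h
  have h3 : 0 ≤ 1 / Real.cos θ ^ 2 := by positivity
  have h4 := mul_le_mul_of_nonneg_left h1.1 hp
  have h5 := mul_le_mul_of_nonneg_left h1.2 hp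
  unfold ampLog'
  rw [abs_le]
  constructor <;> nlinarith

/-- The residual of the Liouville–Green approximation. -/
def lgResidual (p θ : ℝ) : ℝ := ampLog' p θ + ampLog p θ ^ 2 + damping p θ * ampLog p θ

lemma abs_lgResidual_le {p θ : ℝ} (hp : 0 ≤ p) (h : θ ∈ Set.Ioc 0 (Real.pi / 4)) :
    |lgResidual p θ| ≤ 18 * p + 1 + 3 * (p + 1) ^ 2 := by
  have h1 := abs_ampLog_le hp h
  have h2 := abs_ampLog'_le hp h
  have h0 := h.1
  have h3 : |ampLog p θ ^ 2| ≤ (p + 1) ^ 2 := by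
    rw [abs_pow]
    have : |ampLog p θ| ≤ p + 1 := h1.trans (by nlinarith [lt_one_of_mem h])
    gcongr
  have h4 : |damping p θ * ampLog p θ| ≤ 2 * (p + 1) ^ 2 := by
    rw [abs_mul, abs_of_nonneg (damping_nonneg hp h)]
    calc _ ≤ (2 * p + 2) / θ * ((p + 1) * θ) :=
          mul_le_mul (damping_le hp h) h1 (abs_nonneg _) (by positivity)
      _ = _ := by field_simp
  unfold lgResidual
  have := abs_add_three (ampLog' p θ) (ampLog p θ ^ 2) (damping p θ * ampLog p θ)
  linarith

lemma phase_div_sin_bounds {θ : ℝ} (h : θ ∈ Set.Ioc 0 (Real.pi / 4)) :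
    1 / 2 ≤ phase θ / Real.sin θ ∧ phase θ / Real.sin θ ≤ 2 := by
  have hs := sin_pos_of_mem h
  have hb := phase_bounds h
  have h1 := Real.sin_le h.1.le
  have h2 := half_le_sin h
  rw [le_div_iff₀ hs, div_le_iff₀ hs]
  constructor <;> linarith

lemma amp_bounds {p θ : ℝ} (hp : 0 ≤ p) (h : θ ∈ Set.Ioc 0 (Real.pi / 4)) :
    Real.exp (-(p + 1)) ≤ amp p θ ∧ amp p θ ≤ Real.exp (p + 1) := by
  have hs := sin_pos_of_mem h
  have hc := cos_pos_of_mem h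
  have hph := phase_pos h
  have hb := phase_div_sin_bounds h
  have h2 := Real.log_two_lt_d9
  have hl2 := Real.log_pos one_lt_two
  have h1 : |Real.log (phase θ) - Real.log (Real.sin θ)| ≤ 1 := by
    rw [← Real.log_div hph.ne' hs.ne', abs_le]
    have e1 := Real.log_le_log (by positivity) hb.2
    have e2 := Real.log_le_log (by positivity) hb.1
    rw [one_div, Real.log_inv] at e2
    constructor <;> linarith
  have h3 : |Real.log (Real.cos θ)| ≤ 1 := by
    have e1 := Real.log_le_log (by positivity) (half_le_cos h)
    rw [one_div, Real.log_inv] at e1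
    have e2 := Real.log_nonpos hc.le (Real.cos_le_one θ)
    rw [abs_le]; constructor <;> linarith
  rw [abs_le] at h1 h3
  have h4 := mul_le_mul_of_nonneg_left h1.1 hp
  have h5 := mul_le_mul_of_nonneg_left h1.2 hp
  unfold amp
  constructor <;> apply Real.exp_le_exp.2 <;> linarith

lemma tendsto_phase_div_sin :
    Filter.Tendsto (fun θ => phase θ / Real.sin θ) (nhdsWithin 0 (Set.Ioi 0)) (nhds 1) := by
  have hmem : Set.Ioc 0 (Real.pi / 4) ∈ nhdsWithin (0 : ℝ) (Set.Ioi 0) :=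
    Ioc_mem_nhdsGT (by positivity)
  have hlim : Filter.Tendsto (fun θ : ℝ => 4 * θ ^ 2) (nhdsWithin 0 (Set.Ioi 0)) (nhds 0) := by
    have : Continuous fun θ : ℝ => 4 * θ ^ 2 := by fun_prop
    simpa using (this.tendsto 0).mono_left nhdsWithin_le_nhds
  rw [tendsto_iff_norm_sub_tendsto_zero]
  refine squeeze_zero' (Filter.Eventually.of_forall fun _ => norm_nonneg _) ?_ hlim
  filter_upwards [hmem] with θ h
  have hs := sin_pos_of_mem h
  rw [Real.norm_eq_abs, show phase θ / Real.sin θ - 1 = (phase θ - Real.sin θ) / Real.sin θ by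
    field_simp, abs_div, abs_of_pos hs, div_le_iff₀ hs]
  have h0 := h.1
  have h1 := sub_sin_mul_cos_mem h
  have h2 := half_le_sin h
  have h3 := Real.sin_ge_sub_cube h0.le
  have h4 := Real.sin_le h0.le
  have h5 : |phase θ - Real.sin θ| ≤ θ ^ 3 := by
    unfold phase
    rw [abs_le]
    have := pow_pos h0 3
    constructor <;> linarith
  nlinarith

lemma tendsto_amp (p : ℝ) :
    Filter.Tendsto (amp p) (nhdsWithin 0 (Set.Ioi 0)) (nhds 1) := by
  have h1 : Filter.Tendsto (fun θ => Real.log (phase θ / Real.sin θ))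
      (nhdsWithin 0 (Set.Ioi 0)) (nhds 0) := by
    simpa using tendsto_phase_div_sin.log one_ne_zero
  have h2 : Filter.Tendsto (fun θ => Real.log (Real.cos θ))
      (nhdsWithin 0 (Set.Ioi 0)) (nhds 0) := by
    have : Filter.Tendsto Real.cos (nhdsWithin 0 (Set.Ioi 0)) (nhds 1) := by
      simpa using (Real.continuous_cos.tendsto 0).mono_left nhdsWithin_le_nhds
    simpa using this.log one_ne_zero
  have h3 := ((((h1.const_mul p).sub h2).div_const 2).rexp)
  simp only [mul_zero, sub_zero, zero_div, Real.exp_zero] at h3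
  refine h3.congr' ?_
  filter_upwards [Ioc_mem_nhdsGT (show (0:ℝ) < Real.pi / 4 by positivity)] with θ h
  rw [amp, Real.log_div (phase_pos h).ne' (sin_pos_of_mem h).ne']

/-- The leading Bessel approximation to a normalized Laguerre function, in the variable `θ`. -/
def besselApprox (m : ℕ) (ν θ : ℝ) : ℝ :=
  m.factorial * (amp (2 * m + 1) θ * besselReg m (ν * phase θ))

/-- The derivative of `besselApprox`. -/
def besselApprox' (m : ℕ) (ν θ : ℝ) : ℝ :=
  m.factorial * (amp (2 * m + 1) θ * (ampLog (2 * m + 1) θ * besselReg m (ν * phase θ) -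
    ν * phase θ / 2 * besselReg (m + 1) (ν * phase θ) * (ν * Real.cos θ ^ 2)))

lemma hasDerivAt_besselApprox {m : ℕ} {ν θ : ℝ} (h : θ ∈ Set.Ioc 0 (Real.pi / 4)) :
    HasDerivAt (besselApprox m ν) (besselApprox' m ν θ) θ := by
  have h1 := (hasDerivAt_besselReg m (ν * phase θ)).comp θ ((hasDerivAt_phase θ).const_mul ν)
  refine (((hasDerivAt_amp (p := 2 * m + 1) h).mul h1).const_mul (m.factorial : ℝ)).congr_deriv ?_
  simp only [besselApprox', Function.comp]
  ring

lemma hasDerivAt_besselApprox' {m : ℕ} {ν θ : ℝ} (h : θ ∈ Set.Ioc 0 (Real.pi / 4)) :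
    HasDerivAt (besselApprox' m ν)
      (-damping (2 * m + 1) θ * besselApprox' m ν θ - ν ^ 2 * Real.cos θ ^ 4 * besselApprox m ν θ +
        lgResidual (2 * m + 1) θ * besselApprox m ν θ) θ := by
  have hs := (sin_pos_of_mem h).ne'
  have hc := (cos_pos_of_mem h).ne'
  have hp := (phase_pos h).ne'
  have hx := (hasDerivAt_phase θ).const_mul ν
  have h1 := (hasDerivAt_besselReg m (ν * phase θ)).comp θ hx
  have h2 := (hasDerivAt_deriv_besselReg m (ν * phase θ)).comp θ hx
  have h3 := (((Real.hasDerivAt_cos θ).pow 2).const_mul ν)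
  have h4 := (((hasDerivAt_amp (p := 2 * m + 1) h).mul
    (((hasDerivAt_ampLog (p := 2 * m + 1) h).mul h1).add (h2.mul h3))).const_mul (m.factorial : ℝ))
  refine (h4.congr_of_eventuallyEq (Filter.Eventually.of_forall fun y => ?_)).congr_deriv ?_
  · simp only [besselApprox', Function.comp, Pi.mul_apply, Pi.add_apply, Pi.pow_apply]
    ring
  · simp only [besselApprox', besselApprox, lgResidual, Function.comp, Pi.mul_apply, Pi.add_apply]
    simp
    set u := besselReg m (ν * phase θ)
    set v := besselReg (m + 1) (ν * phase θ)
    have key : phase θ * (2 * ampLog (2 * m + 1) θ * Real.cos θ ^ 2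
        - 2 * Real.cos θ * Real.sin θ + damping (2 * m + 1) θ * Real.cos θ ^ 2) =
        (2 * m + 1) * Real.cos θ ^ 4 := by
      unfold ampLog damping phaseLog
      field_simp
      ring
    linear_combination (-(m.factorial : ℝ) * amp (2 * m + 1) θ * ν ^ 2 / 2 * v) * key

lemma besselApprox_decay (m : ℕ) :
    ∃ C : ℝ, 0 < C ∧ ∀ ν θ : ℝ, 0 ≤ ν → θ ∈ Set.Ioc 0 (Real.pi / 4) →
      besselApprox m ν θ ^ 2 * (1 + ν * θ) ^ (2 * m + 1) ≤ C := by
  obtain ⟨B, hB, h⟩ := besselReg_decay m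
  set M : ℝ := Real.exp ((2 * m + 1) + 1)
  refine ⟨(m.factorial : ℝ) ^ 2 * M ^ 2 * 2 ^ (2 * m + 1) * B, by positivity, fun ν θ hν hθ => ?_⟩
  have h0 := hθ.1
  have hph := phase_pos hθ
  have h1 := h (ν * phase θ) (by positivity)
  have h2 : 0 < amp (2 * m + 1) θ := Real.exp_pos _
  have h3 : amp (2 * m + 1) θ ≤ M := (amp_bounds (by positivity) hθ).2
  have h4 : 1 + ν * θ ≤ 2 * (1 + ν * phase θ) := by
    nlinarith [(phase_bounds hθ).1]
  calc besselApprox m ν θ ^ 2 * (1 + ν * θ) ^ (2 * m + 1)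
      ≤ ((m.factorial : ℝ) * (M * |besselReg m (ν * phase θ)|)) ^ 2 *
          (2 * (1 + ν * phase θ)) ^ (2 * m + 1) := by
        rw [← sq_abs (besselApprox m ν θ), besselApprox, abs_mul, abs_mul, abs_of_pos h2,
          Nat.abs_cast]
        gcongr
    _ = (m.factorial : ℝ) ^ 2 * M ^ 2 * 2 ^ (2 * m + 1) *
          (besselReg m (ν * phase θ) ^ 2 * (1 + ν * phase θ) ^ (2 * m + 1)) := by
        rw [mul_pow 2, mul_pow, mul_pow, sq_abs]; ring
    _ ≤ _ := by gcongr

lemma tendsto_besselApprox (m : ℕ) (ν : ℝ) :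
    Filter.Tendsto (besselApprox m ν) (nhdsWithin 0 (Set.Ioi 0)) (nhds 1) ∧
    Filter.Tendsto (besselApprox' m ν) (nhdsWithin 0 (Set.Ioi 0)) (nhds 0) := by
  have hcont : ∀ m, Continuous (besselReg m) := fun m =>
    continuous_iff_continuousAt.2 fun x => (hasDerivAt_besselReg m x).continuousAt
  have hphc : Continuous phase :=
    continuous_iff_continuousAt.2 fun x => (hasDerivAt_phase x).continuousAt
  have hph0 : phase 0 = 0 := by simp [phase]
  have hu : Filter.Tendsto (fun θ => besselReg m (ν * phase θ)) (nhdsWithin 0 (Set.Ioi 0))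
      (nhds (1 / (m.factorial : ℝ))) := by
    have hc : Continuous fun θ => besselReg m (ν * phase θ) :=
      (hcont m).comp (continuous_const.mul hphc)
    have := (hc.tendsto 0).mono_left (nhdsWithin_le_nhds (s := Set.Ioi 0))
    simpa [hph0, besselReg, besselAux_zero] using this
  have hv : Filter.Tendsto (fun θ => ν * phase θ / 2 * besselReg (m + 1) (ν * phase θ) *
      (ν * Real.cos θ ^ 2)) (nhdsWithin 0 (Set.Ioi 0)) (nhds 0) := by
    have hc : Continuous fun θ => ν * phase θ / 2 * besselReg (m + 1) (ν * phase θ) *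
      (ν * Real.cos θ ^ 2) := by
      have := (hcont (m + 1)).comp (continuous_const.mul hphc : Continuous fun θ => ν * phase θ)
      have h2 := Real.continuous_cos
      exact ((((continuous_const.mul hphc).div_const 2)).mul this).mul
        (continuous_const.mul (h2.pow 2))
    have := (hc.tendsto 0).mono_left (nhdsWithin_le_nhds (s := Set.Ioi 0))
    simpa [hph0] using this
  have hl : Filter.Tendsto (ampLog (2 * m + 1)) (nhdsWithin 0 (Set.Ioi 0)) (nhds 0) := by
    have hlim : Filter.Tendsto (fun θ : ℝ => ((2 * m + 1 : ℝ) + 1) * θ) (nhdsWithin 0 (Set.Ioi 0))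
        (nhds 0) := by
      have : Continuous fun θ : ℝ => ((2 * m + 1 : ℝ) + 1) * θ := by fun_prop
      simpa using (this.tendsto 0).mono_left nhdsWithin_le_nhds
    refine squeeze_zero_norm' ?_ hlim
    filter_upwards [Ioc_mem_nhdsGT (show (0:ℝ) < Real.pi / 4 by positivity)] with θ h
    exact abs_ampLog_le (by positivity) h
  have ha := tendsto_amp (2 * m + 1)
  have hm : (m.factorial : ℝ) ≠ 0 := by positivity
  constructor
  · have := (ha.mul hu).const_mul (m.factorial : ℝ)
    rwa [one_mul, mul_one_div_cancel hm] at this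
  · have := (ha.mul ((hl.mul hu).sub hv)).const_mul (m.factorial : ℝ)
    simp only [zero_mul, sub_zero, mul_zero] at this
    exact this

lemma shifted_energy_le {x y q d K : ℝ} (hK : 0 ≤ K) (h : q ^ 2 * y ^ 2 ≤ 4 * d ^ 2 * K) :
    (x + q / 2 * y) ^ 2 + K ≤ (2 + 2 * d ^ 2) * (x ^ 2 + K) := by
  have h1 : (x + q / 2 * y) ^ 2 ≤ 2 * x ^ 2 + q ^ 2 * y ^ 2 / 2 := by
    linarith [sq_nonneg (x - q / 2 * y)]
  have h2 : 0 ≤ d ^ 2 * x ^ 2 := by positivity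
  linarith

lemma energy_le_shifted {x y q d K : ℝ} (hK : 0 ≤ K) (h : q ^ 2 * y ^ 2 ≤ 4 * d ^ 2 * K) :
    x ^ 2 + K ≤ (3 + 2 * d ^ 2) * ((x + q / 2 * y) ^ 2 + K) := by
  have h1 : x ^ 2 ≤ 2 * (x + q / 2 * y) ^ 2 + q ^ 2 * y ^ 2 / 2 := by
    linarith [sq_nonneg (x + q * y)]
  have h2 : 0 ≤ d ^ 2 * (x + q / 2 * y) ^ 2 := by positivity
  have h3 := sq_nonneg (x + q / 2 * y)
  linarith

set_option maxHeartbeats 1600000 in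
/-- Energy estimate for a forced oscillator with damping `damping (2 * m + 1)`, starting from rest,
whose forcing decays like a Bessel function. -/
lemma forced_oscillator_bound (m : ℕ) :
    ∃ K : ℝ, 0 < K ∧ ∀ (ν r : ℝ) (D D1 κ κ1 R : ℝ → ℝ), 2 ≤ ν →
      (∀ θ ∈ Set.Ioc 0 (Real.pi / 4), HasDerivAt D (D1 θ) θ) →
      (∀ θ ∈ Set.Ioc 0 (Real.pi / 4),
        HasDerivAt D1 (-damping (2 * m + 1) θ * D1 θ - κ θ * D θ + R θ) θ) →
      (∀ θ ∈ Set.Ioc 0 (Real.pi / 4), HasDerivAt κ (κ1 θ) θ) →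
      (∀ θ ∈ Set.Ioc 0 (Real.pi / 4), κ1 θ ≤ 0) →
      (∀ θ ∈ Set.Ioc 0 (Real.pi / 4), ν ^ 2 / 4 ≤ κ θ) →
      (∀ θ ∈ Set.Ioc 0 (Real.pi / 4), R θ ^ 2 * (1 + ν * θ) ^ (2 * m + 1) ≤ r ^ 2) →
      Filter.Tendsto (fun θ => D1 θ ^ 2 + κ θ * D θ ^ 2) (nhdsWithin 0 (Set.Ioi 0)) (nhds 0) →
      ∀ b ∈ Set.Ioc 0 (Real.pi / 4),
        (D1 b ^ 2 + ν ^ 2 * D b ^ 2 / 4) * (1 + ν * b) ^ (2 * m + 1) ≤ K * (r ^ 2 * b ^ 2) := by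
  obtain ⟨p, hp⟩ : ∃ p : ℝ, p = 2 * m + 1 := ⟨_, rfl⟩
  obtain ⟨N, hN⟩ : ∃ N : ℕ, N = 2 * m + 1 := ⟨_, rfl⟩
  have hpN : p = (N : ℝ) := by rw [hp, hN]; push_cast; ring
  rw [← hN, ← hp]
  have hp0 : 0 ≤ p := by rw [hpN]; positivity
  obtain ⟨c, hc⟩ : ∃ c : ℝ, c = (p + 1) ^ 2 + 2 * p + 1 := ⟨_, rfl⟩
  have hc0 : 0 < c := by rw [hc]; positivity
  obtain ⟨d, hd⟩ : ∃ d : ℝ, d = 2 * p + 2 := ⟨_, rfl⟩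
  have hd0 : 0 < d := by rw [hd]; positivity
  obtain ⟨L, hL⟩ : ∃ L : ℝ, L = 2 * (2 + 2 * d ^ 2) * Real.exp 1 + 2 := ⟨_, rfl⟩
  have hL0 : 0 < L := by rw [hL]; positivity
  obtain ⟨K1, hK1⟩ : ∃ K : ℝ, K = 2 ^ N * (2 ^ N * (Real.exp (2 * c + 1) * L)) := ⟨_, rfl⟩
  obtain ⟨K2, hK2⟩ : ∃ K : ℝ, K = 2 ^ N * Real.exp 1 := ⟨_, rfl⟩
  have hK10 : 0 < K1 := by rw [hK1]; positivity
  have hK20 : 0 < K2 := by rw [hK2]; positivity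
  refine ⟨(3 + 2 * d ^ 2) * K1 + K2, by positivity, ?_⟩
  intro ν r D D1 κ κ1 R hν dD dD1 dκ hκ1 hκ hR hlim b hb
  have hν0 : 0 < ν := by linarith
  have hκ0 : ∀ θ ∈ Set.Ioc 0 (Real.pi / 4), 0 ≤ κ θ := fun θ h =>
    le_trans (by positivity) (hκ θ h)
  have near : ∀ b ∈ Set.Ioc 0 (Real.pi / 4),
      D1 b ^ 2 + κ b * D b ^ 2 ≤ Real.exp 1 * (r ^ 2 * b ^ 2) := by
    intro b hb
    have hsub : ∀ θ ∈ Set.Ioc 0 b, θ ∈ Set.Ioc 0 (Real.pi / 4) := fun θ h => ⟨h.1, h.2.trans hb.2⟩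
    refine energy_near hb.1 (fun θ h => dD θ (hsub θ h)) (fun θ h => dD1 θ (hsub θ h))
      (fun θ h => dκ θ (hsub θ h)) (fun θ h => damping_nonneg hp0 (hsub θ h))
      (fun θ h => hκ0 θ (hsub θ h)) (fun θ h => hκ1 θ (hsub θ h)) (fun θ h => ?_) hlim
    have h0 := h.1
    have h1 : 1 ≤ (1 + ν * θ) ^ N := one_le_pow₀ (by nlinarith)
    have := hR θ (hsub θ h)
    nlinarith [sq_nonneg (R θ)]
  have hb0 := hb.1
  have hDκ : ν ^ 2 * D b ^ 2 / 4 ≤ κ b * D b ^ 2 := by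
    have := mul_le_mul_of_nonneg_right (hκ b hb) (sq_nonneg (D b))
    linarith
  have hr : 0 ≤ r ^ 2 * b ^ 2 := by positivity
  rcases le_total (ν * b) 1 with h1 | h1
  · have h2 : (1 + ν * b) ^ N ≤ 2 ^ N := by gcongr; linarith
    calc _ ≤ (Real.exp 1 * (r ^ 2 * b ^ 2)) * 2 ^ N := by
          gcongr; linarith [near b hb]
      _ = K2 * (r ^ 2 * b ^ 2) := by rw [hK2]; ring
      _ ≤ _ := by
          gcongr
          have : 0 ≤ (3 + 2 * d ^ 2) * K1 := by positivity
          linarith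
  · have hα0 : 0 < 1 / ν := by positivity
    have hαb : 1 / ν ≤ b := by rw [div_le_iff₀ hν0]; linarith
    have hα : 1 / ν ∈ Set.Ioc 0 (Real.pi / 4) := ⟨hα0, hαb.trans hb.2⟩
    have hsub : ∀ θ ∈ Set.Icc (1 / ν) b, θ ∈ Set.Ioc 0 (Real.pi / 4) := fun θ h =>
      ⟨hα0.trans_le h.1, h.2.trans hb.2⟩
    obtain ⟨s, hs⟩ : ∃ s : ℝ, s ^ 2 = 2 * r ^ 2 / ν ^ N :=
      ⟨Real.sqrt (2 * r ^ 2 / ν ^ N), Real.sq_sqrt (by positivity)⟩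
    have S_le : ∀ θ ∈ Set.Ioc 0 (Real.pi / 4), Real.sin θ ^ N / Real.cos θ ≤ 2 * θ ^ N := by
      intro θ h
      rw [div_le_iff₀ (cos_pos_of_mem h)]
      have h3 : Real.sin θ ^ N ≤ θ ^ N := by
        have := Real.sin_le h.1.le
        have := (sin_pos_of_mem h).le
        gcongr
      have h4 : 0 < θ ^ N := pow_pos h.1 N
      nlinarith [half_le_cos h]
    have far := energy_far (S := fun θ => Real.sin θ ^ N / Real.cos θ) (r := s) (c := c) hα0 hαb hν0
      hc0.le (by field_simp; exact le_rfl) (fun θ h => dD θ (hsub θ h)) (fun θ h => dD1 θ (hsub θ h))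
      (fun θ h => hasDerivAt_damping (hsub θ h))
      (fun θ h => dκ θ (hsub θ h)) ?_ ?_ (fun θ h => hκ θ (hsub θ h)) (fun θ h => hκ1 θ (hsub θ h))
      (fun θ h => hc ▸ abs_potential_le hp0 (hsub θ h)) ?_
    · have hE : Real.sin (1 / ν) ^ N / Real.cos (1 / ν) * ((D1 (1 / ν) + damping p (1 / ν) / 2 *
          D (1 / ν)) ^ 2 + κ (1 / ν) * D (1 / ν) ^ 2) ≤
          (2 * (2 + 2 * d ^ 2) * Real.exp 1) * (r ^ 2 * b ^ 2 / ν ^ N) := by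
        have e1 := S_le _ hα
        have e2 := near _ hα
        have e3 := damping_le hp0 hα
        have e4 := damping_nonneg hp0 hα
        have e5 : damping p (1 / ν) ≤ d * ν := by rw [hd]; simpa using e3
        have e6 := mul_le_mul_of_nonneg_right (hκ _ hα) (sq_nonneg (D (1 / ν)))
        have e7 : damping p (1 / ν) ^ 2 * D (1 / ν) ^ 2 ≤ 4 * d ^ 2 * (κ (1 / ν) * D (1 / ν) ^ 2) := by
          calc _ ≤ (d * ν) ^ 2 * D (1 / ν) ^ 2 := by gcongr
            _ = 4 * d ^ 2 * (ν ^ 2 / 4 * D (1 / ν) ^ 2) := by ring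
            _ ≤ _ := by gcongr
        have e8 : (D1 (1 / ν) + damping p (1 / ν) / 2 * D (1 / ν)) ^ 2 + κ (1 / ν) * D (1 / ν) ^ 2 ≤
            (2 + 2 * d ^ 2) * (D1 (1 / ν) ^ 2 + κ (1 / ν) * D (1 / ν) ^ 2) := by
          exact shifted_energy_le (mul_nonneg (hκ0 _ hα) (sq_nonneg (D (1 / ν)))) e7
        have e9 : (1 / ν) ^ 2 ≤ b ^ 2 := by gcongr
        have e10 := hκ0 _ hα
        calc _ ≤ 2 * (1 / ν) ^ N * ((2 + 2 * d ^ 2) * (Real.exp 1 * (r ^ 2 * b ^ 2))) := by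
              gcongr
              refine e8.trans ?_
              gcongr
              exact e2.trans (by gcongr)
          _ = _ := by rw [one_div_pow]; ring
      have hEb : Real.sin b ^ N / Real.cos b * ((D1 b + damping p b / 2 * D b) ^ 2 + κ b * D b ^ 2) ≤
          Real.exp (2 * c + 1) * L * (r ^ 2 * b ^ 2 / ν ^ N) := by
        refine far.trans ?_
        rw [mul_assoc]
        gcongr
        rw [hs]
        calc _ ≤ (2 * (2 + 2 * d ^ 2) * Real.exp 1) * (r ^ 2 * b ^ 2 / ν ^ N) +
              2 * r ^ 2 / ν ^ N * b ^ 2 := by linarith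
          _ = _ := by rw [hL]; ring
      have hSb : (b / 2) ^ N ≤ Real.sin b ^ N / Real.cos b := by
        have e1 := half_le_sin hb
        have e2 := cos_pos_of_mem hb
        have e3 := sin_pos_of_mem hb
        rw [le_div_iff₀ e2]
        calc (b / 2) ^ N * Real.cos b ≤ Real.sin b ^ N * 1 := by
              gcongr; exact Real.cos_le_one b
          _ = _ := mul_one _
      have hκb := hκ0 b hb
      have hT : ((D1 b + damping p b / 2 * D b) ^ 2 + κ b * D b ^ 2) * (1 + ν * b) ^ N ≤
          K1 * (r ^ 2 * b ^ 2) := by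
        have e1 : (1 + ν * b) ^ N ≤ 2 ^ N * (2 ^ N * ν ^ N) * (b / 2) ^ N := by
          rw [← mul_pow, ← mul_pow, ← mul_pow]
          gcongr
          linarith
        calc _ ≤ ((D1 b + damping p b / 2 * D b) ^ 2 + κ b * D b ^ 2) *
              (2 ^ N * (2 ^ N * ν ^ N) * (Real.sin b ^ N / Real.cos b)) := by
              gcongr
              exact e1.trans (by gcongr)
          _ = 2 ^ N * (2 ^ N * ν ^ N) * (Real.sin b ^ N / Real.cos b *
              ((D1 b + damping p b / 2 * D b) ^ 2 + κ b * D b ^ 2)) := by ring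
          _ ≤ 2 ^ N * (2 ^ N * ν ^ N) * (Real.exp (2 * c + 1) * L * (r ^ 2 * b ^ 2 / ν ^ N)) := by
              gcongr
          _ = K1 * (r ^ 2 * b ^ 2) := by rw [hK1]; field_simp
      have hq : damping p b ^ 2 * D b ^ 2 ≤ 4 * d ^ 2 * (κ b * D b ^ 2) := by
        have e3 := damping_le hp0 hb
        have e4 := damping_nonneg hp0 hb
        have e5 : damping p b ≤ d * ν := by
          rw [hd]
          refine e3.trans ?_
          rw [div_le_iff₀ hb0]
          nlinarith
        calc _ ≤ (d * ν) ^ 2 * D b ^ 2 := by gcongr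
          _ = 4 * d ^ 2 * (ν ^ 2 * D b ^ 2 / 4) := by ring
          _ ≤ _ := by gcongr
      have hfin : D1 b ^ 2 + ν ^ 2 * D b ^ 2 / 4 ≤
          (3 + 2 * d ^ 2) * ((D1 b + damping p b / 2 * D b) ^ 2 + κ b * D b ^ 2) := by
        exact (add_le_add_right hDκ _).trans
          (energy_le_shifted (mul_nonneg hκb (sq_nonneg (D b))) hq)
      calc _ ≤ (3 + 2 * d ^ 2) * ((D1 b + damping p b / 2 * D b) ^ 2 + κ b * D b ^ 2) *
            (1 + ν * b) ^ N := by gcongr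
        _ = (3 + 2 * d ^ 2) * (((D1 b + damping p b / 2 * D b) ^ 2 + κ b * D b ^ 2) *
            (1 + ν * b) ^ N) := by ring
        _ ≤ (3 + 2 * d ^ 2) * (K1 * (r ^ 2 * b ^ 2)) := by gcongr
        _ ≤ _ := by
            rw [← mul_assoc]
            gcongr
            linarith
    · intro θ h
      have h := hsub θ h
      have h3 := (cos_pos_of_mem h).ne'
      have h4 := (sin_pos_of_mem h).ne'
      refine (((Real.hasDerivAt_sin θ).pow N).div (Real.hasDerivAt_cos θ) h3).congr_deriv ?_
      simp only [damping, Pi.pow_apply]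
      rw [hpN, hN]
      simp only [Nat.add_sub_cancel]
      field_simp
      ring
    · intro θ h
      have h := hsub θ h
      have h3 := cos_pos_of_mem h
      have h4 := sin_pos_of_mem h
      positivity
    · intro θ h
      have h := hsub θ h
      have h0 := h.1
      have h5 : (ν * θ) ^ N ≤ (1 + ν * θ) ^ N := by gcongr; linarith
      have h6 := hR θ h
      rw [hs, le_div_iff₀ (by positivity)]
      calc _ ≤ 2 * θ ^ N * R θ ^ 2 * ν ^ N := by
            gcongr; exact S_le θ h
        _ = 2 * (R θ ^ 2 * (ν * θ) ^ N) := by rw [mul_pow]; ring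
        _ ≤ 2 * (R θ ^ 2 * (1 + ν * θ) ^ N) := by gcongr
        _ ≤ 2 * r ^ 2 := by gcongr

/-- A solution of the Laguerre equation in Liouville form, in the variable `θ`, stays close
to its Bessel approximation. -/
lemma laguerre_bessel_comparison (m : ℕ) :
    ∃ C : ℝ, 0 < C ∧ ∀ (ν : ℝ) (f f1 : ℝ → ℝ), 2 ≤ ν →
      (∀ θ ∈ Set.Ioc 0 (Real.pi / 4), HasDerivAt f (f1 θ) θ) →
      (∀ θ ∈ Set.Ioc 0 (Real.pi / 4), HasDerivAt f1
        (-damping (2 * m + 1) θ * f1 θ - ν ^ 2 * Real.cos θ ^ 4 * f θ) θ) →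
      Filter.Tendsto f (nhdsWithin 0 (Set.Ioi 0)) (nhds 1) →
      Filter.Tendsto f1 (nhdsWithin 0 (Set.Ioi 0)) (nhds 0) →
      ∀ b ∈ Set.Ioc 0 (Real.pi / 4), f b ^ 2 * (1 + ν * b) ^ (2 * m + 1) ≤ C ∧
        (f1 b - besselApprox' m ν b) ^ 2 * (1 + ν * b) ^ (2 * m + 1) ≤ C * b ^ 2 := by
  obtain ⟨B, hB, hg⟩ := besselApprox_decay m
  obtain ⟨K, hK, hosc⟩ := forced_oscillator_bound m
  obtain ⟨ρ, hρ⟩ : ∃ ρ : ℝ, ρ = 18 * (2 * m + 1) + 1 + 3 * ((2 * m + 1) + 1) ^ 2 := ⟨_, rfl⟩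
  have hρ0 : 0 < ρ := by rw [hρ]; positivity
  refine ⟨2 * (K * (ρ ^ 2 * B)) + 2 * B, by positivity, fun ν f f1 hν hf hf1 hf0 hf10 b hb => ?_⟩
  have hν0 : 0 < ν := by linarith
  have main := hosc ν (ρ * Real.sqrt B) (fun θ => f θ - besselApprox m ν θ)
    (fun θ => f1 θ - besselApprox' m ν θ) (fun θ => ν ^ 2 * Real.cos θ ^ 4)
    (fun θ => ν ^ 2 * (4 * Real.cos θ ^ 3 * -Real.sin θ))
    (fun θ => -(lgResidual (2 * m + 1) θ * besselApprox m ν θ)) hν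
    (fun θ h => (hf θ h).sub (hasDerivAt_besselApprox h)) ?_ ?_ ?_ ?_ ?_ ?_ b hb
  · rw [mul_pow ρ, Real.sq_sqrt hB.le] at main
    have hb0 := hb.1
    have hQ : 0 < (1 + ν * b) ^ (2 * m + 1) := by positivity
    have hK' : 0 < K * (ρ ^ 2 * B) := by positivity
    rw [← mul_assoc K] at main
    obtain ⟨K', hKK⟩ : ∃ K', K' = K * (ρ ^ 2 * B) := ⟨_, rfl⟩
    obtain ⟨Q, hQQ⟩ : ∃ Q, Q = (1 + ν * b) ^ (2 * m + 1) := ⟨_, rfl⟩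
    obtain ⟨g, hgg⟩ : ∃ g, g = besselApprox m ν b := ⟨_, rfl⟩
    obtain ⟨g1, hgg1⟩ : ∃ g, g = besselApprox' m ν b := ⟨_, rfl⟩
    have h2 := hg ν b hν0.le hb
    rw [← hKK, ← hQQ, ← hgg, ← hgg1] at main
    rw [← hQQ, ← hgg] at h2
    rw [← hQQ] at hQ ⊢
    rw [← hKK] at hK' ⊢
    rw [← hgg1]
    have h6 : K' * b ^ 2 ≤ K' :=
      mul_le_of_le_one_right hK'.le (pow_le_one₀ hb0.le (lt_one_of_mem hb).le)
    constructor
    · have h4 : (f b - g) ^ 2 ≤ (f1 b - g1) ^ 2 + ν ^ 2 * (f b - g) ^ 2 / 4 := by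
        nlinarith [sq_nonneg (f1 b - g1),
          mul_nonneg (show 0 ≤ ν ^ 2 - 4 by nlinarith) (sq_nonneg (f b - g))]
      have h5 := mul_le_mul_of_nonneg_right h4 hQ.le
      have h1 : f b ^ 2 ≤ 2 * (f b - g) ^ 2 + 2 * g ^ 2 := by nlinarith [sq_nonneg (f b - 2 * g)]
      have := mul_le_mul_of_nonneg_right h1 hQ.le
      linarith
    · have h4 : (f1 b - g1) ^ 2 ≤ (f1 b - g1) ^ 2 + ν ^ 2 * (f b - g) ^ 2 / 4 := by
        have : 0 ≤ ν ^ 2 * (f b - g) ^ 2 / 4 := by positivity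
        linarith
      have h5 := mul_le_mul_of_nonneg_right h4 hQ.le
      have h6 : 0 ≤ (K' + 2 * B) * b ^ 2 := by positivity
      linarith
  · intro θ h
    refine ((hf1 θ h).sub (hasDerivAt_besselApprox' h)).congr_deriv ?_
    ring
  · intro θ _
    refine (((Real.hasDerivAt_cos θ).pow 4).const_mul (ν ^ 2)).congr_deriv ?_
    simp
  · intro θ h
    have := sin_pos_of_mem h
    have := cos_pos_of_mem h
    have : 0 ≤ ν ^ 2 * (4 * Real.cos θ ^ 3 * Real.sin θ) := by positivity
    linarith
  · intro θ h
    have h1 := half_le_cos_sq h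
    have h2 : 1 / 4 ≤ Real.cos θ ^ 4 := by nlinarith
    nlinarith [sq_nonneg ν]
  · intro θ h
    have h1 := hg ν θ hν0.le h
    have h2 : lgResidual (2 * m + 1) θ ^ 2 ≤ ρ ^ 2 := by
      rw [← sq_abs]
      have := abs_lgResidual_le (p := 2 * m + 1) (by positivity) h
      rw [← hρ] at this
      gcongr
    have h0 := h.1
    calc _ = lgResidual (2 * m + 1) θ ^ 2 * (besselApprox m ν θ ^ 2 * (1 + ν * θ) ^ (2 * m + 1)) := by
          ring
      _ ≤ ρ ^ 2 * B := by gcongr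
      _ = _ := by rw [mul_pow, Real.sq_sqrt hB.le]
  · have h1 := tendsto_besselApprox m ν
    have hc : Continuous fun θ : ℝ => ν ^ 2 * Real.cos θ ^ 4 := by
      have := Real.continuous_cos
      fun_prop
    have h2 := (hc.tendsto 0).mono_left (nhdsWithin_le_nhds (s := Set.Ioi 0))
    have := ((hf10.sub h1.2).pow 2).add (h2.mul ((hf0.sub h1.1).pow 2))
    simpa using this

open Polynomial in
/-- The polynomials `Q_j` in `(d/ds)^j (e^{-s} s^N) = e^{-s} s^{N-j} Q_j(s)`. -/
def rodriguesPoly (N : ℕ) : ℕ → ℝ[X]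
  | 0 => 1
  | j + 1 => (C ((N : ℝ) - j) - X) * rodriguesPoly N j + X * derivative (rodriguesPoly N j)

lemma iteratedDeriv_exp_neg_mul_pow (N j : ℕ) (hj : j ≤ N) :
    iteratedDeriv j (fun s : ℝ => Real.exp (-s) * s ^ N) =
      fun s => Real.exp (-s) * s ^ (N - j) * (rodriguesPoly N j).eval s := by
  induction j with
  | zero => funext s; simp [rodriguesPoly]
  | succ j ih =>
    rw [iteratedDeriv_succ, ih (by omega)]
    funext s
    obtain ⟨i, rfl⟩ : ∃ i, N = j + 1 + i := ⟨N - (j + 1), by omega⟩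
    have e1 : j + 1 + i - j = i + 1 := by omega
    have e2 : j + 1 + i - (j + 1) = i := by omega
    rw [e1, e2]
    have h1 : HasDerivAt (fun s : ℝ => Real.exp (-s)) (-Real.exp (-s)) s := by
      simpa using (hasDerivAt_neg s).exp
    refine (((h1.mul (hasDerivAt_pow (i + 1) s)).mul
      ((rodriguesPoly (j + 1 + i) j).hasDerivAt s)).deriv).trans ?_
    simp [rodriguesPoly]
    ring

open Polynomial in
lemma rodriguesPoly_ode (N j : ℕ) :
    X * derivative (derivative (rodriguesPoly N j)) +
      (C ((N : ℝ) - j) + 1 - X) * derivative (rodriguesPoly N j) +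
      (j : ℝ[X]) * rodriguesPoly N j = 0 := by
  induction j with
  | zero => simp [rodriguesPoly]
  | succ j ih =>
    have hd : derivative (rodriguesPoly N (j + 1)) = -((j : ℝ[X]) + 1) * rodriguesPoly N j := by
      simp only [rodriguesPoly, derivative_add, derivative_mul, derivative_sub, derivative_C,
        derivative_X]
      linear_combination ih
    have hdd : derivative (derivative (rodriguesPoly N (j + 1))) =
        -((j : ℝ[X]) + 1) * derivative (rodriguesPoly N j) := by
      rw [hd]
      simp
    rw [hdd, hd]
    have hC : (C ((N : ℝ) - ((j + 1 : ℕ) : ℝ)) : ℝ[X]) = C ((N : ℝ) - j) - 1 := by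
      rw [← C_1, ← C_sub]; push_cast; ring_nf
    rw [hC]
    simp only [rodriguesPoly]
    push_cast
    ring

lemma rodriguesPoly_eval_zero (m k j : ℕ) (hj : j ≤ k) :
    (rodriguesPoly (k + m) j).eval 0 * ((k + m - j).factorial : ℝ) = ((k + m).factorial : ℝ) := by
  induction j with
  | zero => simp [rodriguesPoly]
  | succ j ih =>
    rw [← ih (by omega)]
    obtain ⟨i, rfl⟩ : ∃ i, k = j + 1 + i := ⟨k - (j + 1), by omega⟩
    have e1 : j + 1 + i + m - j = (i + m) + 1 := by omega
    have e2 : j + 1 + i + m - (j + 1) = i + m := by omega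
    rw [e1, e2, Nat.factorial_succ]
    simp [rodriguesPoly]
    ring

/-- The regular solution of `s H'' + (m + 1) H' + (ν - s) / 4 * H = 0`, `H 0 = 1`, with
`ν = 4k + 2(m + 1)`. -/
def laguerreSol (m k : ℕ) (s : ℝ) : ℝ :=
  (m.factorial : ℝ) / ((k + m).factorial : ℝ) *
    (Real.exp (-s / 2) * (rodriguesPoly (k + m) k).eval s)

/-- The derivative of `laguerreSol`. -/
def laguerreSol' (m k : ℕ) (s : ℝ) : ℝ :=
  (m.factorial : ℝ) / ((k + m).factorial : ℝ) *
    (Real.exp (-s / 2) * ((rodriguesPoly (k + m) k).derivative.eval s -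
      (rodriguesPoly (k + m) k).eval s / 2))

lemma laguerreSol_zero (m k : ℕ) : laguerreSol m k 0 = 1 := by
  have h := rodriguesPoly_eval_zero m k k le_rfl
  have h1 : ((k + m).factorial : ℝ) ≠ 0 := by positivity
  rw [Nat.add_sub_cancel_left] at h
  unfold laguerreSol
  simp only [neg_zero, zero_div, Real.exp_zero, one_mul]
  field_simp
  linarith

lemma hasDerivAt_exp_neg_half (s : ℝ) :
    HasDerivAt (fun s : ℝ => Real.exp (-s / 2)) (Real.exp (-s / 2) * (-1 / 2)) s :=
  ((hasDerivAt_neg s).div_const 2).exp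

lemma hasDerivAt_laguerreSol (m k : ℕ) (s : ℝ) :
    HasDerivAt (laguerreSol m k) (laguerreSol' m k s) s := by
  refine (((hasDerivAt_exp_neg_half s).mul
    ((rodriguesPoly (k + m) k).hasDerivAt s)).const_mul _).congr_deriv ?_
  unfold laguerreSol'
  ring

lemma hasDerivAt_laguerreSol' (m k : ℕ) {s : ℝ} (hs : 0 < s) :
    HasDerivAt (laguerreSol' m k)
      (-((m + 1) * laguerreSol' m k s + ((nuv (m + 1) k : ℝ) - s) / 4 * laguerreSol m k s) / s)
      s := by
  refine (((hasDerivAt_exp_neg_half s).mul (((rodriguesPoly (k + m) k).derivative.hasDerivAt s).sub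
    (((rodriguesPoly (k + m) k).hasDerivAt s).div_const 2))).const_mul _).congr_deriv ?_
  have h := congrArg (Polynomial.eval s) (rodriguesPoly_ode (k + m) k)
  simp only [Polynomial.eval_add, Polynomial.eval_mul, Polynomial.eval_X, Polynomial.eval_sub,
    Polynomial.eval_C, Polynomial.eval_one, Polynomial.eval_natCast, Polynomial.eval_zero] at h
  unfold laguerreSol laguerreSol' nuv
  rw [eq_div_iff hs.ne']
  simp only [Pi.sub_apply]
  push_cast at h ⊢
  linear_combination ((m.factorial : ℝ) / ((k + m).factorial : ℝ) * Real.exp (-s / 2)) * h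

lemma continuous_laguerreSol (m k : ℕ) : Continuous (laguerreSol m k) := by
  have := (rodriguesPoly (k + m) k).continuous
  unfold laguerreSol
  fun_prop

lemma continuous_laguerreSol' (m k : ℕ) : Continuous (laguerreSol' m k) := by
  have := (rodriguesPoly (k + m) k).continuous
  have := (rodriguesPoly (k + m) k).derivative.continuous
  unfold laguerreSol'
  fun_prop

lemma genLaguerre_mul_exp (m k : ℕ) {t : ℝ} (ht : 0 < t) :
    genLaguerre k m t * Real.exp (-t / 2) =
      ((k + m).factorial : ℝ) / ((m.factorial : ℝ) * (k.factorial : ℝ)) * laguerreSol m k t := by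
  unfold genLaguerre laguerreSol
  have h1 : (fun s : ℝ => Real.exp (-s) * s ^ ((k : ℝ) + (m : ℝ))) =
      fun s : ℝ => Real.exp (-s) * s ^ (k + m) := by
    funext s
    rw [← Nat.cast_add, Real.rpow_natCast]
  rw [h1, iteratedDeriv_exp_neg_mul_pow _ _ (Nat.le_add_right k m), Nat.add_sub_cancel_left,
    Real.rpow_neg ht.le, Real.rpow_natCast]
  simp only [Real.exp_neg t]
  have h2 := (Real.exp_pos t).ne'
  have h3 : t ^ m ≠ 0 := (pow_pos ht m).ne'
  field_simp

lemma chiHatB_eq (m k : ℕ) {lam : ℝ} (hl : 0 < lam) :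
    chiHatB (m + 1) k lam = Real.sin lam / lam * ((2 : ℝ) ^ (-(m : ℝ) / 2) / (m.factorial : ℝ)) *
      ((∫ s in (0 : ℝ)..(lam / 2), s ^ m * laguerreSol m k s) / (lam / 2) ^ (m + 1)) := by
  have hν : (0 : ℝ) < (nuv (m + 1) k : ℝ) := by unfold nuv; positivity
  unfold chiHatB
  set ν : ℝ := (nuv (m + 1) k : ℝ)
  have hm : (((m + 1 : ℕ) : ℝ) - 1) = m := by push_cast; ring
  set c : ℝ := rk (m + 1) k * (((k + m).factorial : ℝ) / ((m.factorial : ℝ) * (k.factorial : ℝ))) *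
    ν ^ (-(m : ℝ) / 2)
  have h1 : ∫ t in (0 : ℝ)..(lam / (2 * ν)),
      lagFun (m + 1) k (ν * t) * t ^ ((((m + 1 : ℕ) : ℝ) - 1) / 2) =
      ∫ t in (0 : ℝ)..(lam / (2 * ν)), c * ((ν * t) ^ m * laguerreSol m k (ν * t)) := by
    refine intervalIntegral.integral_congr_ae (Filter.Eventually.of_forall fun t ht => ?_)
    rw [Set.uIoc_of_le (by positivity)] at ht
    have ht0 := ht.1
    have hνt : 0 < ν * t := by positivity
    unfold lagFun
    rw [hm, mul_assoc (rk _ _), genLaguerre_mul_exp m k hνt]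
    have e1 : (ν * t) ^ m = ν ^ ((m : ℝ) / 2) * ν ^ ((m : ℝ) / 2) * (t ^ ((m : ℝ) / 2) *
        t ^ ((m : ℝ) / 2)) := by
      rw [← Real.rpow_add hν, ← Real.rpow_add ht0, add_halves, Real.rpow_natCast,
        Real.rpow_natCast, mul_pow]
    have e2 : ν ^ (-(m : ℝ) / 2) * ν ^ ((m : ℝ) / 2) = 1 := by
      rw [← Real.rpow_add hν, neg_div, neg_add_cancel, Real.rpow_zero]
    rw [e1, Real.mul_rpow hν.le ht0.le]
    simp only [c]
    linear_combination -(rk (m + 1) k * (((k + m).factorial : ℝ) / ((m.factorial : ℝ) *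
      (k.factorial : ℝ))) * laguerreSol m k (ν * t) * ν ^ ((m : ℝ) / 2) * t ^ ((m : ℝ) / 2) *
      t ^ ((m : ℝ) / 2)) * e2
  have h2 : ν * (lam / (2 * ν)) = lam / 2 := by field_simp
  rw [h1, intervalIntegral.integral_const_mul,
    intervalIntegral.integral_comp_mul_left (fun s => s ^ m * laguerreSol m k s) hν.ne', mul_zero,
    h2, smul_eq_mul]
  have h3 : rk (m + 1) k * rk (m + 1) k = (k.factorial : ℝ) / ((k + m).factorial : ℝ) := by
    unfold rk
    rw [Real.mul_self_sqrt (by positivity)]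
    congr 3
    omega
  have h4 : (2 * ν) ^ ((((m + 1 : ℕ) : ℝ) + 1) / 2) * ν ^ (-(m : ℝ) / 2) * ν⁻¹ =
      2 ^ (m + 1) * (2 : ℝ) ^ (-(m : ℝ) / 2) := by
    rw [Real.mul_rpow (by norm_num) hν.le, ← Real.rpow_neg_one ν, ← Real.rpow_natCast 2 (m + 1),
      mul_assoc, mul_assoc, ← Real.rpow_add hν, ← Real.rpow_add hν,
      ← Real.rpow_add (by norm_num : (0:ℝ) < 2)]
    have e1 : (((m + 1 : ℕ) : ℝ) + 1) / 2 + (-(m : ℝ) / 2 + -1) = 0 := by push_cast; ring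
    have e2 : ((m + 1 : ℕ) : ℝ) + -(m : ℝ) / 2 = (((m + 1 : ℕ) : ℝ) + 1) / 2 := by
      push_cast; ring
    rw [e1, e2, Real.rpow_zero, mul_one]
  set I := ∫ s in (0 : ℝ)..(lam / 2), s ^ m * laguerreSol m k s
  have h5 : rk (m + 1) k * (Real.sin lam / lam ^ (m + 1 + 1)) *
      (2 * ν) ^ ((((m + 1 : ℕ) : ℝ) + 1) / 2) * (c * (ν⁻¹ * I)) =
      (rk (m + 1) k * rk (m + 1) k) * (((k + m).factorial : ℝ) / ((m.factorial : ℝ) *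
        (k.factorial : ℝ))) * (Real.sin lam / lam ^ (m + 1 + 1)) *
      ((2 * ν) ^ ((((m + 1 : ℕ) : ℝ) + 1) / 2) * ν ^ (-(m : ℝ) / 2) * ν⁻¹) * I := by
    simp only [c]; ring
  rw [h5, h3, h4, div_pow]
  have f1 : ((k + m).factorial : ℝ) ≠ 0 := by positivity
  have f2 : (k.factorial : ℝ) ≠ 0 := by positivity
  have f3 : (m.factorial : ℝ) ≠ 0 := by positivity
  field_simp
  ring

/-- The Laguerre solution and its derivative in the angular variable. -/
lemma laguerreSol_angular_bounds (m : ℕ) :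
    ∃ C : ℝ, 0 < C ∧ ∀ (k : ℕ) (ν : ℝ), ν = (nuv (m + 1) k : ℝ) → ∀ θ ∈ Set.Ioc 0 (Real.pi / 4),
      laguerreSol m k (ν * Real.sin θ ^ 2) ^ 2 * (1 + ν * θ) ^ (2 * m + 1) ≤ C ∧
      (2 * ν * Real.sin θ * Real.cos θ * laguerreSol' m k (ν * Real.sin θ ^ 2) -
        besselApprox' m ν θ) ^ 2 * (1 + ν * θ) ^ (2 * m + 1) ≤ C * θ ^ 2 := by
  obtain ⟨C, hC, h⟩ := laguerre_bessel_comparison m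
  refine ⟨C, hC, fun k ν hν θ hθ => ?_⟩
  have hν2 : 2 ≤ ν := by
    have : 2 ≤ nuv (m + 1) k := by unfold nuv; omega
    rw [hν]
    exact_mod_cast this
  have hin : ∀ θ : ℝ, HasDerivAt (fun θ => ν * Real.sin θ ^ 2)
      (2 * ν * Real.sin θ * Real.cos θ) θ := fun θ =>
    (((Real.hasDerivAt_sin θ).pow 2).const_mul ν).congr_deriv (by simp; ring)
  refine h ν (fun θ => laguerreSol m k (ν * Real.sin θ ^ 2))
    (fun θ => 2 * ν * Real.sin θ * Real.cos θ * laguerreSol' m k (ν * Real.sin θ ^ 2)) hν2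
    ?_ ?_ ?_ ?_ θ hθ
  · intro θ _
    refine ((hasDerivAt_laguerreSol m k _).comp θ (hin θ)).congr_deriv ?_
    ring
  · intro θ hθ
    have hs := sin_pos_of_mem hθ
    have hc := cos_pos_of_mem hθ
    have hν0 : 0 < ν := by linarith
    have h1 := (hasDerivAt_laguerreSol' m k (s := ν * Real.sin θ ^ 2) (by positivity)).comp θ (hin θ)
    have h2 := (((Real.hasDerivAt_sin θ).const_mul (2 * ν)).mul (Real.hasDerivAt_cos θ)).mul h1
    refine h2.congr_deriv ?_
    rw [← hν]
    simp only [damping, Function.comp, Pi.mul_apply]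
    have e : Real.cos θ ^ 2 = 1 - Real.sin θ ^ 2 := Real.cos_sq' θ
    field_simp
    set u := laguerreSol m k (ν * Real.sin θ ^ 2)
    set v := laguerreSol' m k (ν * Real.sin θ ^ 2)
    linear_combination (4 * ν * u * Real.cos θ ^ 2) * e
  · have hc : Continuous fun θ : ℝ => laguerreSol m k (ν * Real.sin θ ^ 2) :=
      (continuous_laguerreSol m k).comp (by have := Real.continuous_sin; fun_prop)
    have := (hc.tendsto 0).mono_left (nhdsWithin_le_nhds (s := Set.Ioi 0))
    simpa [laguerreSol_zero] using this
  · have hc : Continuous fun θ : ℝ =>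
        2 * ν * Real.sin θ * Real.cos θ * laguerreSol' m k (ν * Real.sin θ ^ 2) := by
      have h1 := Real.continuous_sin
      have h2 := Real.continuous_cos
      have h3 := (continuous_laguerreSol' m k).comp
        (by fun_prop : Continuous fun θ : ℝ => ν * Real.sin θ ^ 2)
      exact (by fun_prop : Continuous fun θ : ℝ => 2 * ν * Real.sin θ * Real.cos θ).mul h3
    have := (hc.tendsto 0).mono_left (nhdsWithin_le_nhds (s := Set.Ioi 0))
    simpa using this

lemma arcsin_sqrt_mem {y : ℝ} (hy : 0 < y) (hy2 : y ≤ 1 / 2) :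
    Real.arcsin (Real.sqrt y) ∈ Set.Ioc 0 (Real.pi / 4) ∧
      Real.sin (Real.arcsin (Real.sqrt y)) ^ 2 = y := by
  have h1 : 0 < Real.sqrt y := Real.sqrt_pos.2 hy
  have h2 : Real.sqrt y ≤ Real.sin (Real.pi / 4) := by
    rw [Real.sin_pi_div_four]
    refine Real.sqrt_le_iff.2 ⟨by positivity, ?_⟩
    rw [div_pow, Real.sq_sqrt (by norm_num)]
    linarith
  have h3 : Real.sqrt y ≤ 1 := h2.trans (Real.sin_le_one _)
  refine ⟨⟨Real.arcsin_pos.2 h1, ?_⟩, ?_⟩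
  · refine (Real.arcsin_le_iff_le_sin ⟨by linarith, h3⟩ ⟨?_, ?_⟩).2 h2 <;>
      linarith [Real.pi_pos]
  · rw [Real.sin_arcsin (by linarith) h3, Real.sq_sqrt hy.le]

lemma Afun_sin_sq {θ : ℝ} (h : θ ∈ Set.Ioc 0 (Real.pi / 4)) :
    Afun (Real.sin θ ^ 2) = phase θ := by
  have hs := sin_pos_of_mem h
  have hc := cos_pos_of_mem h
  have h1 : Real.sin θ ^ 2 - (Real.sin θ ^ 2) ^ 2 = (Real.sin θ * Real.cos θ) ^ 2 := by
    rw [mul_pow, Real.cos_sq']; ring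
  unfold Afun phase
  rw [h1, Real.sqrt_sq hs.le, Real.sqrt_sq (mul_pos hs hc).le,
    Real.arcsin_sin (by linarith [h.1, Real.pi_pos]) (by linarith [h.2, Real.pi_pos])]
  ring

lemma abs_le_rpow_of_sq_mul_pow_le (m : ℕ) {C J Y y t : ℝ} (hC : 0 ≤ C) (hJ : 0 < J)
    (hJY : J ≤ 2 * Y ^ 2) (hY : 0 ≤ Y) (ht : 0 ≤ t) (h : y ^ 2 * Y ^ (2 * m + 1) ≤ C * t ^ 2) :
    |y| ≤ 2 ^ (2 * m + 1) * (1 + C) * t * J ^ (-(2 * (m : ℝ) + 1) / 4) := by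
  have hβ : 0 < J ^ ((2 * (m : ℝ) + 1) / 4) := Real.rpow_pos_of_pos hJ _
  rw [neg_div, Real.rpow_neg hJ.le, ← div_eq_mul_inv, le_div_iff₀ hβ]
  refine le_of_pow_le_pow_left₀ (n := 4) (by norm_num) (by positivity) ?_
  have e1 : (J ^ ((2 * (m : ℝ) + 1) / 4)) ^ 4 = J ^ (2 * m + 1) := by
    rw [← Real.rpow_natCast, ← Real.rpow_mul hJ.le, ← Real.rpow_natCast]
    congr 1
    push_cast
    ring
  have e2 : |y| ^ 4 = (y ^ 2) ^ 2 := by rw [← sq_abs y]; ring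
  rw [mul_pow, e1, e2]
  have hD : (2 : ℝ) ^ (2 * m + 1) * C ^ 2 ≤ (2 ^ (2 * m + 1) * (1 + C)) ^ 4 := by
    rw [mul_pow]
    have h1 : (1 : ℝ) ≤ 2 ^ (2 * m + 1) := one_le_pow₀ (by norm_num)
    have h2 : C ^ 2 ≤ (1 + C) ^ 4 :=
      calc C ^ 2 ≤ (1 + C) ^ 2 := by gcongr; linarith
        _ ≤ (1 + C) ^ 4 := pow_le_pow_right₀ (by linarith) (by norm_num)
    have h3 : (2 : ℝ) ^ (2 * m + 1) ≤ (2 ^ (2 * m + 1)) ^ 4 := le_self_pow₀ h1 (by norm_num)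
    gcongr
  calc (y ^ 2) ^ 2 * J ^ (2 * m + 1) ≤ (y ^ 2) ^ 2 * (2 * Y ^ 2) ^ (2 * m + 1) := by gcongr
    _ = 2 ^ (2 * m + 1) * (y ^ 2 * Y ^ (2 * m + 1)) ^ 2 := by
        rw [mul_pow, mul_pow, ← pow_mul, ← pow_mul, ← pow_mul, mul_comm 2 (2 * m + 1)]; ring
    _ ≤ 2 ^ (2 * m + 1) * (C * t ^ 2) ^ 2 := by gcongr
    _ = (2 ^ (2 * m + 1) * C ^ 2) * t ^ 4 := by ring
    _ ≤ (2 ^ (2 * m + 1) * (1 + C)) ^ 4 * t ^ 4 := by gcongr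
    _ = _ := by ring

lemma jap_pos (x : ℝ) : 0 < jap x := Real.sqrt_pos.2 (by positivity)

lemma jap_le {x : ℝ} (hx : 0 ≤ x) : jap x ≤ 1 + x :=
  Real.sqrt_le_iff.2 ⟨by linarith, by nlinarith⟩

/-- Integrating the Laguerre equation by parts reduces the integral of a solution to boundary
values, up to a lower order remainder. -/
lemma integral_laguerre_by_parts (m : ℕ) {ν x B β : ℝ} {H H1 : ℝ → ℝ} (hν : 0 < ν) (hx : 0 < x)
    (hxν : x ≤ ν / 2) (hβ : β ≤ m + 1 / 2) (hH : ∀ s, HasDerivAt H (H1 s) s) (hH1c : Continuous H1)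
    (hH1 : ∀ s, 0 < s → HasDerivAt H1 (-((m + 1) * H1 s + (ν - s) / 4 * H s) / s) s)
    (hB : ∀ s ∈ Set.Ioc 0 x, |H s| ≤ B * (s / x) ^ (-β)) :
    |(∫ s in (0 : ℝ)..x, s ^ m * H s) / x ^ (m + 1) + 4 * H1 x / (ν - x)| ≤
      (16 + 32 * (m + 3)) * (B / ν ^ 2) := by
  have hHc : Continuous H := continuous_iff_continuousAt.2 fun s => (hH s).continuousAt
  have hpos : ∀ s ∈ Set.Icc 0 x, ν / 2 ≤ ν - s := fun s h => by linarith [h.2]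
  have hne : ∀ s ∈ Set.Icc 0 x, ν - s ≠ 0 := fun s h => by linarith [hpos s h]
  have hB0 : 0 ≤ B := by
    have := hB x ⟨hx, le_rfl⟩
    rw [div_self hx.ne', Real.one_rpow, mul_one] at this
    exact (abs_nonneg _).trans this
  obtain ⟨F, hF⟩ : ∃ F : ℝ → ℝ, F = fun s =>
    s ^ (m + 1) * (-(4 * H1 s / (ν - s)) + 4 * H s / (ν - s) ^ 2) := ⟨_, rfl⟩
  obtain ⟨G, hG⟩ : ∃ G : ℝ → ℝ, G = fun s =>
    s ^ m * H s * (4 * ((m + 1) / (ν - s) ^ 2 + 2 * s / (ν - s) ^ 3)) := ⟨_, rfl⟩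
  have hsub : ContinuousOn (fun s => ν - s) (Set.Icc 0 x) := by fun_prop
  have hGc : ContinuousOn G (Set.Icc 0 x) := by
    rw [hG]
    refine ((continuous_pow m).mul hHc).continuousOn.mul (continuousOn_const.mul ((continuousOn_const.div
      (hsub.pow 2) fun s h => pow_ne_zero 2 (hne s h)).add (ContinuousOn.div (by fun_prop)
      (hsub.pow 3) fun s h => pow_ne_zero 3 (hne s h))))
  have hFc : ContinuousOn F (Set.Icc 0 x) := by
    rw [hF]
    refine (continuous_pow (m + 1)).continuousOn.mul ((((continuous_const.mul hH1c).continuousOn.div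
      hsub hne).neg).add ((continuous_const.mul hHc).continuousOn.div (hsub.pow 2)
      fun s h => pow_ne_zero 2 (hne s h)))
  have hGi : IntervalIntegrable G volume 0 x :=
    ContinuousOn.intervalIntegrable (by rwa [Set.uIcc_of_le hx.le])
  have hHi : IntervalIntegrable (fun s => s ^ m * H s) volume 0 x :=
    ((continuous_pow m).mul hHc).intervalIntegrable 0 x
  have hder : ∀ s ∈ Set.Ioo 0 x, HasDerivAt F (s ^ m * H s + G s) s := by
    intro s hs
    have h0 := hs.1
    have h1 := hne s ⟨hs.1.le, hs.2.le⟩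
    have h2 : HasDerivAt (fun s => ν - s) (-1) s := by
      simpa using (hasDerivAt_id s).const_sub ν
    rw [hF, hG]
    refine ((hasDerivAt_pow (m + 1) s).mul ((((hH1 s h0).const_mul 4).div h2 h1).neg.add
      (((hH s).const_mul 4).div (h2.pow 2) (pow_ne_zero 2 h1)))).congr_deriv ?_
    simp only [Nat.add_sub_cancel, Pi.pow_apply, Pi.add_apply, Pi.neg_apply, Pi.div_apply]
    push_cast
    field_simp
    ring
  have hint := intervalIntegral.integral_eq_sub_of_hasDerivAt_of_le hx.le hFc hder (hHi.add hGi)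
  rw [intervalIntegral.integral_add hHi hGi] at hint
  have hF0 : F 0 = 0 := by rw [hF]; simp
  have hFx : F x = x ^ (m + 1) * (-(4 * H1 x / (ν - x)) + 4 * H x / (ν - x) ^ 2) := by rw [hF]
  rw [hF0, hFx, sub_zero] at hint
  have hexp : 1 / 2 ≤ (m : ℝ) - β + 1 := by linarith
  have hinv : ∀ s ∈ Set.Icc 0 x, 1 / (ν - s) ≤ 2 / ν := fun s h => by
    rw [div_le_div_iff₀ (by linarith [hpos s h]) hν]
    linarith [hpos s h]
  have hinv0 : ∀ s ∈ Set.Icc 0 x, 0 ≤ 1 / (ν - s) := fun s h => by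
    have := hpos s h
    have : 0 < ν - s := by linarith
    positivity
  have hbound : |∫ s in (0 : ℝ)..x, G s| ≤ 32 * (m + 3) * (B / ν ^ 2) * x ^ (m + 1) := by
    have hi : IntervalIntegrable (fun s => 16 * (m + 3) * (B / ν ^ 2) * x ^ β * s ^ ((m : ℝ) - β))
        volume 0 x := (intervalIntegral.intervalIntegrable_rpow' (by linarith)).const_mul _
    rw [← Real.norm_eq_abs]
    refine (intervalIntegral.norm_integral_le_of_norm_le hx.le
      (Filter.Eventually.of_forall fun s hs => ?_) hi).trans ?_
    · have h0 := hs.1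
      have h1 : s ∈ Set.Icc 0 x := ⟨hs.1.le, hs.2⟩
      have h2 := hinv s h1
      have h3 := hinv0 s h1
      have h4 : 0 ≤ 4 * ((m + 1) / (ν - s) ^ 2 + 2 * s / (ν - s) ^ 3) ∧
          4 * ((m + 1) / (ν - s) ^ 2 + 2 * s / (ν - s) ^ 3) ≤ 16 * (m + 3) / ν ^ 2 := by
        have e : 4 * ((m + 1) / (ν - s) ^ 2 + 2 * s / (ν - s) ^ 3) =
          4 * ((m + 1) * (1 / (ν - s)) ^ 2 + 2 * s * (1 / (ν - s)) ^ 3) := by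
          rw [one_div, inv_pow, inv_pow]; ring
        rw [e]
        refine ⟨by positivity, ?_⟩
        calc _ ≤ 4 * ((m + 1) * (2 / ν) ^ 2 + ν * (2 / ν) ^ 3) := by
              gcongr
              linarith [hs.2]
          _ = _ := by field_simp; ring
      rw [hG, Real.norm_eq_abs, abs_mul, abs_mul, abs_of_nonneg h4.1, abs_of_nonneg (by positivity)]
      calc _ ≤ s ^ m * (B * (s / x) ^ (-β)) * (16 * (m + 3) / ν ^ 2) := by
            gcongr
            · exact h4.1
            · exact hB s hs
            · exact h4.2
        _ = _ := by
            rw [Real.div_rpow h0.le hx.le, Real.rpow_sub h0, Real.rpow_neg h0.le,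
              Real.rpow_neg hx.le, Real.rpow_natCast]
            have := Real.rpow_pos_of_pos h0 β
            have := Real.rpow_pos_of_pos hx β
            field_simp
    · rw [intervalIntegral.integral_const_mul, integral_rpow (Or.inl (by linarith)),
        Real.zero_rpow (by linarith), sub_zero, mul_assoc (16 * ((m : ℝ) + 3) * (B / ν ^ 2)),
        ← mul_div_assoc (x ^ β), ← Real.rpow_add hx]
      have e : β + ((m : ℝ) - β + 1) = ((m + 1 : ℕ) : ℝ) := by push_cast; ring
      rw [e, Real.rpow_natCast]
      have h1 : x ^ (m + 1) / ((m : ℝ) - β + 1) ≤ 2 * x ^ (m + 1) := by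
        rw [div_le_iff₀ (by linarith)]
        have : 0 < x ^ (m + 1) := by positivity
        nlinarith
      calc _ ≤ 16 * (m + 3) * (B / ν ^ 2) * (2 * x ^ (m + 1)) := by gcongr
        _ = _ := by ring
  have hHx : |4 * H x / (ν - x) ^ 2| ≤ 16 * (B / ν ^ 2) := by
    have h1 : x ∈ Set.Icc 0 x := ⟨hx.le, le_rfl⟩
    have h2 := hinv x h1
    have h3 := hinv0 x h1
    have h4 := hB x ⟨hx, le_rfl⟩
    rw [div_self hx.ne', Real.one_rpow, mul_one] at h4
    have e : 4 * H x / (ν - x) ^ 2 = 4 * H x * (1 / (ν - x)) ^ 2 := by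
      rw [one_div, inv_pow]; ring
    rw [e, abs_mul, abs_mul, abs_of_nonneg (pow_nonneg h3 2), abs_of_pos (by norm_num : (0:ℝ) < 4)]
    calc _ ≤ 4 * B * (2 / ν) ^ 2 := by gcongr
      _ = _ := by ring
  have hxm : 0 < x ^ (m + 1) := by positivity
  have key : (∫ s in (0 : ℝ)..x, s ^ m * H s) / x ^ (m + 1) + 4 * H1 x / (ν - x) =
      4 * H x / (ν - x) ^ 2 - (∫ s in (0 : ℝ)..x, G s) / x ^ (m + 1) := by
    have hxne := hne x ⟨hx.le, le_rfl⟩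
    rw [eq_sub_of_add_eq hint]
    field_simp
    ring
  rw [key]
  have h3 : |(∫ s in (0 : ℝ)..x, G s) / x ^ (m + 1)| ≤ 32 * (m + 3) * (B / ν ^ 2) := by
    rw [abs_div, abs_of_pos hxm, div_le_iff₀ hxm]
    exact hbound
  refine (abs_sub _ _).trans ?_
  linarith

/-- Bessel asymptotics of the weighted integral of the Laguerre solution. -/
lemma laguerre_integral_asymptotic (m : ℕ) :
    ∃ C : ℝ, 0 < C ∧ ∀ (k : ℕ) (lam ν θ : ℝ), ν = (nuv (m + 1) k : ℝ) → 0 < lam →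
      θ ∈ Set.Ioc 0 (Real.pi / 4) → Real.sin θ ^ 2 = lam / (2 * ν) →
      |(∫ s in (0 : ℝ)..(lam / 2), s ^ m * laguerreSol m k s) / (lam / 2) ^ (m + 1) -
        m.factorial * (amp (2 * m + 1) θ * (phase θ / Real.sin θ / Real.cos θ) *
          besselReg (m + 1) (ν * phase θ))| ≤
      C * (jap (lam * ν) ^ (-(2 * (m : ℝ) + 1) / 4) / ν ^ 2) := by
  obtain ⟨C, hC, hang⟩ := laguerreSol_angular_bounds m
  obtain ⟨C', hC', hbes⟩ := besselApprox_decay m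
  obtain ⟨D, hD⟩ : ∃ D : ℝ, D = 2 ^ (2 * m + 1) * (1 + C) := ⟨_, rfl⟩
  obtain ⟨D', hD'⟩ : ∃ D : ℝ, D = 2 ^ (2 * m + 1) * (1 + C') := ⟨_, rfl⟩
  have hD0 : 0 < D := by rw [hD]; positivity
  have hD0' : 0 < D' := by rw [hD']; positivity
  refine ⟨(16 + 32 * (m + 3)) * D + 32 * D + 32 * (2 * m + 1 + 1) * D', by positivity, ?_⟩
  intro k lam ν θ hν hl hθ hsin
  have hν0 : 0 < ν := by rw [hν]; unfold nuv; positivity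
  have hs := sin_pos_of_mem hθ
  have hc := cos_pos_of_mem hθ
  have hθ0 := hθ.1
  obtain ⟨x, hx⟩ : ∃ x : ℝ, x = lam / 2 := ⟨_, rfl⟩
  have hx0 : 0 < x := by rw [hx]; positivity
  have hxs : ν * Real.sin θ ^ 2 = x := by rw [hsin, hx]; field_simp
  have hνx : ν - x = ν * Real.cos θ ^ 2 := by rw [← hxs, Real.cos_sq']; ring
  have hxν : x ≤ ν / 2 := by nlinarith [half_le_cos_sq hθ]
  obtain ⟨J, hJ⟩ : ∃ J : ℝ, J = jap (lam * ν) := ⟨_, rfl⟩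
  have hJ0 : 0 < J := hJ ▸ jap_pos _
  have hJle : J ≤ 1 + 2 * x * ν := by
    rw [hJ]
    refine (jap_le (by positivity)).trans_eq ?_
    rw [hx]; ring
  obtain ⟨e, he⟩ : ∃ e : ℝ, e = (2 * (m : ℝ) + 1) / 4 := ⟨_, rfl⟩
  have he' : -(2 * (m : ℝ) + 1) / 4 = -e := by rw [he]; ring
  rw [← hJ, he', ← hx]
  have env : ∀ s θ : ℝ, 0 < s → s ≤ x → θ ∈ Set.Ioc 0 (Real.pi / 4) → ν * Real.sin θ ^ 2 = s →
      (s / x) * J ≤ 2 * (1 + ν * θ) ^ 2 := by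
    intro s θ hs0 hsx hθ hsθ
    have h1 : (s / x) * J ≤ 1 + 2 * s * ν := by
      have h2 : s / x ≤ 1 := (div_le_one hx0).2 hsx
      calc (s / x) * J ≤ (s / x) * (1 + 2 * x * ν) := by gcongr
        _ = s / x + 2 * s * ν := by field_simp
        _ ≤ _ := by linarith
    refine h1.trans ?_
    have h3 := Real.sin_le hθ.1.le
    have h4 := sin_pos_of_mem hθ
    have h5 : Real.sin θ ^ 2 ≤ θ ^ 2 := by gcongr
    have h6 := mul_le_mul_of_nonneg_left h5 (sq_nonneg ν)
    have h7 : 0 < ν * θ := mul_pos hν0 hθ.1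
    rw [← hsθ]
    nlinarith
  have henv := env x θ hx0 le_rfl hθ hxs
  rw [div_self hx0.ne', one_mul] at henv
  obtain ⟨W, hW⟩ : ∃ W : ℝ, W = J ^ (-e) := ⟨_, rfl⟩
  have hW0 : 0 < W := hW ▸ Real.rpow_pos_of_pos hJ0 _
  rw [← hW]
  have hparts := integral_laguerre_by_parts m (B := D * W) (β := e) hν0 hx0 hxν
    (by rw [he]; have : (0 : ℝ) ≤ m := by positivity
        linarith)
    (hasDerivAt_laguerreSol m k) (continuous_laguerreSol' m k)
    (fun s hs => hν ▸ hasDerivAt_laguerreSol' m k hs) (fun s hs => by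
      obtain ⟨h1, h2⟩ := arcsin_sqrt_mem (y := s / ν) (div_pos hs.1 hν0) (by
        rw [div_le_iff₀ hν0]; linarith [hs.2])
      generalize Real.arcsin (Real.sqrt (s / ν)) = φ at h1 h2
      have h3 : ν * Real.sin φ ^ 2 = s := by rw [h2]; field_simp
      have h4 := (hang k ν hν φ h1).1
      rw [h3] at h4
      have hsx : 0 < s / x := div_pos hs.1 hx0
      have hφ := h1.1
      have h5 := abs_le_rpow_of_sq_mul_pow_le m (t := 1) hC.le (mul_pos hsx hJ0)
        (env s φ hs.1 hs.2 h1 h3) (by positivity) zero_le_one (by simpa using h4)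
      rw [he', Real.mul_rpow hsx.le hJ0.le, ← hW, ← hD] at h5
      linarith)
  have hE := (hang k ν hν θ hθ).2
  rw [hxs] at hE
  have hE' := abs_le_rpow_of_sq_mul_pow_le m hC.le hJ0 henv (by positivity) hθ0.le hE
  have hG' := abs_le_rpow_of_sq_mul_pow_le m (t := 1) hC'.le hJ0 henv (by positivity) zero_le_one
    (by simpa using hbes ν θ hν0.le hθ)
  rw [he', ← hW, ← hD] at hE'
  rw [he', ← hW, ← hD', mul_one] at hG'
  obtain ⟨E, hEd⟩ : ∃ E : ℝ, E = 2 * ν * Real.sin θ * Real.cos θ * laguerreSol' m k x -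
    besselApprox' m ν θ := ⟨_, rfl⟩
  rw [← hEd] at hE'
  have hinv : 1 / (Real.sin θ * Real.cos θ ^ 3) ≤ 16 / θ := by
    have h1 := half_le_sin hθ
    have h2 : (1 / 2) ^ 3 ≤ Real.cos θ ^ 3 := by
      have := half_le_cos hθ
      gcongr
    rw [div_le_div_iff₀ (by positivity) hθ0]
    calc 1 * θ = 16 * (θ / 2 * (1 / 2) ^ 3) := by ring
      _ ≤ _ := by gcongr
  have hinv0 : 0 ≤ 1 / (Real.sin θ * Real.cos θ ^ 3) := by positivity
  have hid : ∀ I : ℝ, I - m.factorial * (amp (2 * m + 1) θ *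
      (phase θ / Real.sin θ / Real.cos θ) * besselReg (m + 1) (ν * phase θ)) =
      (I + 4 * laguerreSol' m k x / (ν - x)) -
        2 / ν ^ 2 * (E * (1 / (Real.sin θ * Real.cos θ ^ 3))) -
        2 / ν ^ 2 * (ampLog (2 * m + 1) θ * besselApprox m ν θ *
          (1 / (Real.sin θ * Real.cos θ ^ 3))) := by
    intro I
    rw [hEd, hνx]
    unfold besselApprox besselApprox'
    field_simp
    ring
  rw [hid]
  have hb1 : |2 / ν ^ 2 * (E * (1 / (Real.sin θ * Real.cos θ ^ 3)))| ≤ 32 * D * (W / ν ^ 2) := by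
    rw [abs_mul, abs_mul, abs_of_nonneg hinv0, abs_of_pos (by positivity : 0 < 2 / ν ^ 2)]
    calc _ ≤ 2 / ν ^ 2 * ((D * θ * W) * (16 / θ)) := by gcongr
      _ = _ := by field_simp; ring
  have hb2 : |2 / ν ^ 2 * (ampLog (2 * m + 1) θ * besselApprox m ν θ *
      (1 / (Real.sin θ * Real.cos θ ^ 3)))| ≤ 32 * (2 * m + 1 + 1) * D' * (W / ν ^ 2) := by
    rw [abs_mul, abs_mul, abs_mul, abs_of_nonneg hinv0, abs_of_pos (by positivity : 0 < 2 / ν ^ 2)]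
    have := abs_ampLog_le (p := 2 * m + 1) (by positivity) hθ
    calc _ ≤ 2 / ν ^ 2 * (((2 * m + 1 + 1) * θ) * (D' * W) * (16 / θ)) := by gcongr
      _ = _ := by field_simp; ring
  refine (abs_sub _ _).trans ((add_le_add ((abs_sub _ _).trans (add_le_add hparts hb1)) hb2).trans_eq ?_)
  ring

lemma rpow_mul_besselJ_eq (n : ℕ) {lam ν θ : ℝ} (hν : 0 < ν) (hθ : θ ∈ Set.Ioc 0 (Real.pi / 4))
    (hsin : Real.sin θ ^ 2 = lam / (2 * ν)) :
    (lam * ν) ^ (-(n : ℝ) / 2) * besselJ n (ν * phase θ) =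
      (phase θ / Real.sin θ / (2 * Real.sqrt 2)) ^ n * besselReg n (ν * phase θ) := by
  have hs := sin_pos_of_mem hθ
  have h2 : (0 : ℝ) < Real.sqrt 2 := by positivity
  have h1 : lam * ν = (Real.sqrt 2 * ν * Real.sin θ) ^ 2 := by
    rw [mul_pow, mul_pow, Real.sq_sqrt (by norm_num), hsin]
    field_simp
  have hpos : 0 < Real.sqrt 2 * ν * Real.sin θ := by positivity
  have h3 : (lam * ν) ^ (-(n : ℝ) / 2) = ((Real.sqrt 2 * ν * Real.sin θ) ^ n)⁻¹ := by
    rw [h1, ← Real.rpow_natCast _ 2, ← Real.rpow_mul hpos.le, ← Real.rpow_natCast,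
      ← Real.rpow_neg hpos.le]
    congr 1
    push_cast
    ring
  rw [h3, besselJ_eq, ← mul_assoc, ← inv_pow, ← mul_pow]
  unfold besselReg
  congr 2
  field_simp

/-- The factor relating the Laguerre coefficient to the Bessel function, in the variable `θ`. -/
def omegaAngle (m : ℕ) (θ : ℝ) : ℝ :=
  (2 : ℝ) ^ (-(m : ℝ) / 2) * (amp (2 * m + 1) θ * (phase θ / Real.sin θ / Real.cos θ)) *
    (2 * Real.sqrt 2 / (phase θ / Real.sin θ)) ^ (m + 1)

lemma omegaAngle_bounds (m : ℕ) :
    ∃ c₁ c₂ : ℝ, 0 < c₁ ∧ c₁ ≤ c₂ ∧ ∀ θ ∈ Set.Ioc 0 (Real.pi / 4),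
      c₁ ≤ omegaAngle m θ ∧ omegaAngle m θ ≤ c₂ := by
  obtain ⟨l, hl⟩ : ∃ l : ℝ, l = (2 : ℝ) ^ (-(m : ℝ) / 2) *
    (Real.exp (-((2 * m + 1) + 1)) * (1 / 2 / 1)) * (2 * Real.sqrt 2 / 2) ^ (m + 1) := ⟨_, rfl⟩
  obtain ⟨u, hu⟩ : ∃ u : ℝ, u = (2 : ℝ) ^ (-(m : ℝ) / 2) *
    (Real.exp ((2 * m + 1) + 1) * (2 / (1 / 2))) * (2 * Real.sqrt 2 / (1 / 2)) ^ (m + 1) := ⟨_, rfl⟩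
  have h : ∀ θ ∈ Set.Ioc 0 (Real.pi / 4), l ≤ omegaAngle m θ ∧ omegaAngle m θ ≤ u := by
    intro θ hθ
    obtain ⟨a1, a2⟩ := amp_bounds (p := 2 * m + 1) (by positivity) hθ
    obtain ⟨b1, b2⟩ := phase_div_sin_bounds hθ
    have c1 := half_le_cos hθ
    have c2 := Real.cos_le_one θ
    have c3 := cos_pos_of_mem hθ
    have b3 : 0 < phase θ / Real.sin θ := by linarith
    have a3 : 0 < amp (2 * m + 1) θ := (Real.exp_pos _).trans_le a1
    unfold omegaAngle
    rw [hl, hu]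
    constructor <;> gcongr
  refine ⟨l, u, by rw [hl]; positivity, ?_, h⟩
  have := h (Real.pi / 4) ⟨by positivity, le_rfl⟩
  exact this.1.trans this.2

/-- Bessel-regime asymptotics of `χ̂_B`: there is a function
`Ω ≈ 1` such that for `0 < λ ≤ ν`
`χ̂_B(λ,k) = (sin λ/λ)(λν)^{−n/2} J_n(ν A(λ/(2ν))) Ω(λ,k)
  + O((|sin λ|/λ) ν^{−2} ⟨λν⟩^{−n/2+1/4})`. -/
theorem chiHatB_bessel_regime (n : ℕ) (hn : 1 ≤ n) :
    ∃ Ω : ℝ → ℕ → ℝ, ∃ c₁ c₂ C : ℝ, 0 < c₁ ∧ c₁ ≤ c₂ ∧ 0 < C ∧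
      (∀ (lam : ℝ) (k : ℕ), 0 < lam → c₁ ≤ Ω lam k ∧ Ω lam k ≤ c₂) ∧
      (∀ (k : ℕ) (lam : ℝ), 0 < lam → lam ≤ (nuv n k : ℝ) →
        |chiHatB n k lam -
            (Real.sin lam / lam) * (lam * (nuv n k : ℝ)) ^ (-(n : ℝ) / 2) *
              besselJ n ((nuv n k : ℝ) * Afun (lam / (2 * (nuv n k : ℝ)))) * Ω lam k| ≤
          C * (|Real.sin lam| / lam) * (nuv n k : ℝ) ^ (-(2 : ℝ)) *
            jap (lam * (nuv n k : ℝ)) ^ (-(n : ℝ) / 2 + 1 / 4)) := by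
  obtain ⟨m, rfl⟩ : ∃ m, n = m + 1 := ⟨n - 1, by omega⟩
  obtain ⟨c₁, c₂, hc₁, hc₁₂, hΩ⟩ := omegaAngle_bounds m
  obtain ⟨C, hC, hasymp⟩ := laguerre_integral_asymptotic m
  have hν : ∀ k, (0 : ℝ) < (nuv (m + 1) k : ℝ) := fun k => by unfold nuv; positivity
  refine ⟨fun lam k => omegaAngle m (Real.arcsin (Real.sqrt
    (min lam (nuv (m + 1) k : ℝ) / (2 * (nuv (m + 1) k : ℝ))))), c₁, c₂,
    (2 : ℝ) ^ (-(m : ℝ) / 2) / (m.factorial : ℝ) * C, hc₁, hc₁₂, by positivity, ?_, ?_⟩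
  · intro lam k hl
    have := hν k
    refine hΩ _ (arcsin_sqrt_mem (div_pos (lt_min hl this) (by positivity)) ?_).1
    rw [div_le_iff₀ (by positivity)]
    linarith [min_le_right lam (nuv (m + 1) k : ℝ)]
  · intro k lam hl hle
    have hν0 := hν k
    simp only [min_eq_left hle]
    obtain ⟨hθ, hsin⟩ := arcsin_sqrt_mem (y := lam / (2 * (nuv (m + 1) k : ℝ))) (by positivity)
      (by rw [div_le_iff₀ (by positivity)]; linarith)
    have hA : Afun (lam / (2 * (nuv (m + 1) k : ℝ))) =
        phase (Real.arcsin (Real.sqrt (lam / (2 * (nuv (m + 1) k : ℝ))))) := by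
      rw [← Afun_sin_sq hθ, hsin]
    rw [hA]
    generalize Real.arcsin (Real.sqrt (lam / (2 * (nuv (m + 1) k : ℝ)))) = θ at hθ hsin
    have hmain := hasymp k lam _ θ rfl hl hθ hsin
    have hJ := rpow_mul_besselJ_eq (m + 1) hν0 hθ hsin
    have hexp : -((m + 1 : ℕ) : ℝ) / 2 + 1 / 4 = -(2 * (m : ℝ) + 1) / 4 := by push_cast; ring
    rw [hexp, chiHatB_eq m k hl, mul_assoc (Real.sin lam / lam) (_ ^ _), hJ]
    set ν : ℝ := (nuv (m + 1) k : ℝ)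
    have hs := sin_pos_of_mem hθ
    have hph := phase_pos hθ
    have hcancel : (phase θ / Real.sin θ / (2 * Real.sqrt 2)) ^ (m + 1) *
        (2 * Real.sqrt 2 / (phase θ / Real.sin θ)) ^ (m + 1) = 1 := by
      rw [← mul_pow, div_mul_div_cancel₀ (by positivity), div_self (by positivity), one_pow]
    have hm : (m.factorial : ℝ) ≠ 0 := by positivity
    have key : ∀ I : ℝ, Real.sin lam / lam * ((2 : ℝ) ^ (-(m : ℝ) / 2) / (m.factorial : ℝ)) * I -
        Real.sin lam / lam * ((phase θ / Real.sin θ / (2 * Real.sqrt 2)) ^ (m + 1) *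
          besselReg (m + 1) (ν * phase θ)) * omegaAngle m θ =
        Real.sin lam / lam * ((2 : ℝ) ^ (-(m : ℝ) / 2) / (m.factorial : ℝ)) *
          (I - m.factorial * (amp (2 * m + 1) θ * (phase θ / Real.sin θ / Real.cos θ) *
            besselReg (m + 1) (ν * phase θ))) := by
      intro I
      have h1 : (2 : ℝ) ^ (-(m : ℝ) / 2) / (m.factorial : ℝ) * (m.factorial : ℝ) =
        (2 : ℝ) ^ (-(m : ℝ) / 2) := div_mul_cancel₀ _ hm
      unfold omegaAngle
      linear_combination (Real.sin lam / lam * (amp (2 * m + 1) θ *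
        (phase θ / Real.sin θ / Real.cos θ) * besselReg (m + 1) (ν * phase θ))) * h1 -
        (Real.sin lam / lam * besselReg (m + 1) (ν * phase θ) * (2 : ℝ) ^ (-(m : ℝ) / 2) *
          (amp (2 * m + 1) θ * (phase θ / Real.sin θ / Real.cos θ))) * hcancel
    have hν2 : ν ^ (-(2 : ℝ)) = (ν ^ 2)⁻¹ := by
      rw [Real.rpow_neg hν0.le, ← Real.rpow_natCast]; norm_num
    rw [key, hν2, abs_mul, abs_mul, abs_div, abs_of_pos hl,
      abs_of_pos (by positivity : 0 < (2 : ℝ) ^ (-(m : ℝ) / 2) / (m.factorial : ℝ))]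
    calc _ ≤ |Real.sin lam| / lam * ((2 : ℝ) ^ (-(m : ℝ) / 2) / (m.factorial : ℝ)) *
          (C * (jap (lam * ν) ^ (-(2 * (m : ℝ) + 1) / 4) / ν ^ 2)) := by gcongr
      _ = _ := by ring
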